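/- arXiv:2201.09994 — 3 statements merged into one kernel-verified Lean document; each statement's English description precedes it below -/
import Mathlib

section
/- Let S be a standard graded Koszul algebra over k and R = S/I. If reg^S(R) = 1 (i.e. t_i^S(R) ≤ i + 1 for all i ≥ 1), then R is a Koszul algebra, i.e. reg^R(k) = 0. -/
/-- The free graded module with `b j` generators in degree `j` (i.e. `⊕_j A(-j)^{b j}`). -/
abbrev FreeMod (A : Type*) [CommRing A] (b : ℤ → ℕ) : Type _ :=
  ((j : ℤ) × Fin (b j)) →₀ A

/-- A minimal graded free resolution of the module `M` over the (graded) commutative ring `A`,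
where `hom m` is the set of homogeneous elements of degree `m` of `A`.  The data records the
graded Betti numbers `β i j` (the number of copies of `A(-j)` in homological degree `i`),
the differentials and the augmentation; the conditions say that the differentials are graded of
degree `0` (the entries of their matrices are homogeneous of the appropriate degree), that the
resolution is minimal (all entries have positive degree, equivalently lie in the irrelevant
maximal ideal), and that the complex is exact, resolving `M`. -/
structure MinGradedFreeRes (A : Type*) [CommRing A] (hom : ℕ → Set A)
    (M : Type*) [AddCommGroup M] [Module A M] where
  β : ℕ → ℤ → ℕ
  finβ : ∀ i, (Function.support (β i)).Finite
  d : ∀ i, FreeMod A (β (i + 1)) →ₗ[A] FreeMod A (β i)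
  aug : FreeMod A (β 0) →ₗ[A] M
  graded : ∀ (i : ℕ) (j : ℤ) (a : Fin (β (i + 1) j)) (j' : ℤ) (a' : Fin (β i j')),
      d i (Finsupp.single ⟨j, a⟩ 1) ⟨j', a'⟩ = 0 ∨
      ∃ m : ℕ, (m : ℤ) = j - j' ∧ d i (Finsupp.single ⟨j, a⟩ 1) ⟨j', a'⟩ ∈ hom m
  minimal : ∀ (i : ℕ) (j : ℤ) (a : Fin (β (i + 1) j)) (j' : ℤ) (a' : Fin (β i j')),
      d i (Finsupp.single ⟨j, a⟩ 1) ⟨j', a'⟩ ≠ 0 → j' < j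
  augSurj : Function.Surjective aug
  exact₀ : LinearMap.range (d 0) = LinearMap.ker aug
  exact : ∀ i, LinearMap.range (d (i + 1)) = LinearMap.ker (d i)

/-- The `i`-th total Betti number of a resolution. -/
noncomputable def MinGradedFreeRes.tB {A : Type*} [CommRing A] {hom : ℕ → Set A}
    {M : Type*} [AddCommGroup M] [Module A M]
    (res : MinGradedFreeRes A hom M) (i : ℕ) : ℕ :=
  ∑ j ∈ (res.finβ i).toFinset, res.β i j

/-- The height of an ideal: the infimum of the heights of the primes containing it. -/
noncomputable def idealHeight {A : Type*} [CommRing A] (I : Ideal A) : ℕ∞ :=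
  ⨅ (P : PrimeSpectrum A) (_ : I ≤ P.asIdeal), Order.height P


structure LinCx (S : Type) [CommRing S] where
  B : ℕ → Type
  ft : ∀ i, Fintype (B i)
  a : ∀ i, B (i + 1) → B i → S
  dd : ∀ i s u, (∑ t ∈ (ft (i + 1)).elems, a (i + 1) s t * a i t u) = 0

namespace LinCx

variable {S : Type} [CommRing S] (C : LinCx S)

instance (i : ℕ) : Fintype (C.B i) := C.ft i

def D {V : Type} [AddCommGroup V] [Module S V] (i : ℕ) (x : C.B (i + 1) → V) : C.B i → V :=
  fun t => ∑ s, C.a i s t • x s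

def Cyc {V : Type} [AddCommGroup V] [Module S V] : (i : ℕ) → (C.B i → V) → Prop
  | 0, _ => True
  | i + 1, x => C.D i x = 0

def HH {V : Type} [AddCommGroup V] [Module S V] (gr : ℤ → AddSubgroup V) (i : ℕ) (n : ℤ) : Prop :=
  ∀ x : C.B i → V, (∀ t, x t ∈ gr n) → C.Cyc i x →
    ∃ y : C.B (i + 1) → V, (∀ s, y s ∈ gr (n - 1)) ∧ C.D i y = x

/-- `gr` is stable under the entries. -/
def Stab {V : Type} [AddCommGroup V] [Module S V] (gr : ℤ → AddSubgroup V) : Prop :=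
  ∀ i s t n, ∀ x ∈ gr n, C.a i s t • x ∈ gr (n + 1)

section
variable {V : Type} [AddCommGroup V] [Module S V] {W : Type} [AddCommGroup W] [Module S W]

lemma D_D (i : ℕ) (x : C.B (i + 2) → V) : C.D i (C.D (i + 1) x) = 0 := by
  funext u
  simp only [D, Finset.smul_sum, smul_smul, Pi.zero_apply]
  rw [Finset.sum_comm]
  apply Finset.sum_eq_zero
  intro s _
  rw [← Finset.sum_smul]
  have h : (∑ t, C.a (i + 1) s t * C.a i t u) = 0 := C.dd i s u
  have h' : (∑ t, C.a i t u * C.a (i + 1) s t) = 0 := by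
    rw [← h]; exact Finset.sum_congr rfl fun t _ => mul_comm _ _
  rw [h', zero_smul]

lemma cyc_D (i : ℕ) (x : C.B (i + 1) → V) : C.Cyc i (C.D i x) := by
  cases i with
  | zero => trivial
  | succ i => exact C.D_D i x

lemma D_sub (i : ℕ) (x y : C.B (i + 1) → V) : C.D i (x - y) = C.D i x - C.D i y := by
  funext t
  simp [D, smul_sub]

lemma D_map (f : V →ₗ[S] W) (i : ℕ) (x : C.B (i + 1) → V) :
    C.D i (fun s => f (x s)) = fun t => f (C.D i x t) := by
  funext t
  simp [D]

lemma cyc_map (f : V →ₗ[S] W) (i : ℕ) (x : C.B i → V) (h : C.Cyc i x) :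
    C.Cyc i (fun s => f (x s)) := by
  cases i with
  | zero => trivial
  | succ i =>
    have h : C.D i x = 0 := h
    show C.D i _ = 0
    rw [C.D_map f, h]
    funext t; simp

lemma cyc_of_map (f : V →ₗ[S] W) (hf : Function.Injective f) (i : ℕ) (x : C.B i → V)
    (h : C.Cyc i (fun s => f (x s))) : C.Cyc i x := by
  cases i with
  | zero => trivial
  | succ i =>
    have h : C.D i (fun s => f (x s)) = 0 := h
    rw [C.D_map f] at h
    show C.D i _ = 0
    funext t
    apply hf
    simpa using congrFun h t

lemma D_mem {gr : ℤ → AddSubgroup V} (h : C.Stab gr) (i : ℕ) (n : ℤ) (x : C.B (i + 1) → V)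
    (hx : ∀ s, x s ∈ gr n) (t) : C.D i x t ∈ gr (n + 1) :=
  AddSubgroup.sum_mem _ fun s _ => h i s t n _ (hx s)

/-- kernel step -/
lemma HH_ker {F N : ℤ → AddSubgroup V} {M : ℤ → AddSubgroup W} (f : V →ₗ[S] W)
    (hF : C.Stab F) (hM : ∀ n x, x ∈ M n ↔ ∃ y ∈ F n, f y = x)
    (hN : ∀ n x, x ∈ N n ↔ x ∈ F n ∧ f x = 0) (i : ℕ) (n : ℤ)
    (h1 : C.HH F i n) (h2 : C.HH M (i + 1) (n - 1)) : C.HH N i n := by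
  intro x hx hc
  obtain ⟨y, hy, rfl⟩ := h1 x (fun t => ((hN _ _).1 (hx t)).1) hc
  have e : C.D i (fun s => f (y s)) = 0 := by
    rw [C.D_map f]
    funext t
    exact ((hN _ _).1 (hx t)).2
  obtain ⟨z, hz, hz2⟩ := h2 (fun s => f (y s)) (fun s => (hM _ _).2 ⟨_, hy s, rfl⟩) e
  choose w hw hw2 using fun s => (hM _ _).1 (hz s)
  refine ⟨y - C.D (i + 1) w, fun s => (hN _ _).2 ⟨?_, ?_⟩, ?_⟩
  · refine AddSubgroup.sub_mem _ (hy s) ?_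
    have := C.D_mem hF (i + 1) _ w hw s
    simpa using this
  · have h3 := congrFun (C.D_map f (i + 1) w) s
    have h4 : (fun s => f (w s)) = z := funext hw2
    rw [h4, hz2] at h3
    simp [← h3]
  · rw [D_sub, D_D, sub_zero]

/-- cokernel step -/
lemma HH_coker {F N : ℤ → AddSubgroup V} {M : ℤ → AddSubgroup W} (f : V →ₗ[S] W)
    (hF : C.Stab F) (hM : ∀ n x, x ∈ M n ↔ ∃ y ∈ F n, f y = x)
    (hN : ∀ n x, x ∈ N n ↔ x ∈ F n ∧ f x = 0) (i : ℕ) (n : ℤ)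
    (h1 : C.HH F (i + 1) n) (h2 : C.HH N i (n + 1)) : C.HH M (i + 1) n := by
  intro x hx hc
  choose w hw hw2 using fun s => (hM _ _).1 (hx s)
  have h4 : (fun s => f (w s)) = x := funext hw2
  have hc : C.D i x = 0 := hc
  obtain ⟨y, hy, hy2⟩ := h2 (C.D i w) (fun t => (hN _ _).2 ⟨C.D_mem hF i _ w hw t, by
    have := congrFun (C.D_map f i w) t
    rw [h4, hc] at this
    exact this.symm⟩) (C.cyc_D i w)
  have hy' : ∀ s, y s ∈ F n ∧ f (y s) = 0 := fun s => by
    have := (hN _ _).1 (hy s)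
    simpa using this
  obtain ⟨z, hz, hz2⟩ := h1 (w - y) (fun s => AddSubgroup.sub_mem _ (hw s) (hy' s).1) (by
    show C.D i _ = 0
    rw [D_sub, hy2, sub_self])
  refine ⟨fun s => f (z s), fun s => (hM _ _).2 ⟨_, hz s, rfl⟩, ?_⟩
  rw [D_map, hz2]
  funext s
  simp [hw2, (hy' s).2]

lemma HH_zero {F : ℤ → AddSubgroup V} {M : ℤ → AddSubgroup W} (f : V →ₗ[S] W)
    (hM : ∀ n x, x ∈ M n ↔ ∃ y ∈ F n, f y = x) (n : ℤ)
    (h1 : C.HH F 0 n) : C.HH M 0 n := by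
  intro x hx hc
  choose w hw hw2 using fun s => (hM _ _).1 (hx s)
  obtain ⟨z, hz, hz2⟩ := h1 w hw trivial
  refine ⟨fun s => f (z s), fun s => (hM _ _).2 ⟨_, hz s, rfl⟩, ?_⟩
  rw [D_map, hz2]
  exact funext hw2

lemma HH_inj {F : ℤ → AddSubgroup V} {M : ℤ → AddSubgroup W} (f : V →ₗ[S] W)
    (hf : Function.Injective f)
    (hM : ∀ n x, x ∈ M n ↔ ∃ y ∈ F n, f y = x) (i : ℕ) (n : ℤ)
    (h1 : C.HH M i n) : C.HH F i n := by
  intro x hx hc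
  obtain ⟨z, hz, hz2⟩ := h1 (fun s => f (x s)) (fun s => (hM _ _).2 ⟨_, hx s, rfl⟩)
    (C.cyc_map f i x hc)
  choose w hw hw2 using fun s => (hM _ _).1 (hz s)
  have h4 : (fun s => f (w s)) = z := funext hw2
  refine ⟨w, hw, ?_⟩
  rw [← h4, D_map] at hz2
  funext t
  exact hf (congrFun hz2 t)

end
end LinCx

/-- Grading data on a ring: graded pieces and projections. -/
structure GD (A : Type) [CommRing A] where
  gr : ℤ → AddSubgroup A
  P : ℤ → A →+ A
  P_mem : ∀ n x, P n x ∈ gr n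
  P_of_mem : ∀ n, ∀ x ∈ gr n, P n x = x
  P_mul : ∀ m n, ∀ a ∈ gr m, ∀ x, P n (a * x) = a * P (n - m) x
  neg : ∀ n, n < 0 → ∀ x ∈ gr n, x = 0
  mul_mem : ∀ m n, ∀ a ∈ gr m, ∀ x ∈ gr n, a * x ∈ gr (m + n)

def Fgr {A : Type} [CommRing A] (G : GD A) (b : ℤ → ℕ) (n : ℤ) : AddSubgroup (FreeMod A b) where
  carrier := {x | ∀ σ, x σ ∈ G.gr (n - σ.1)}
  zero_mem' := fun _ => (G.gr _).zero_mem
  add_mem' := fun h1 h2 σ => (G.gr _).add_mem (h1 σ) (h2 σ)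
  neg_mem' := fun h1 σ => (G.gr _).neg_mem (h1 σ)

lemma mem_Fgr {A : Type} [CommRing A] (G : GD A) (b : ℤ → ℕ) (n : ℤ) (x : FreeMod A b) :
    x ∈ Fgr G b n ↔ ∀ σ, x σ ∈ G.gr (n - σ.1) := Iff.rfl

lemma sigma_finite (b : ℤ → ℕ) (hb : (Function.support b).Finite) :
    Finite ((j : ℤ) × Fin (b j)) := by
  have : Finite (Function.support b) := hb
  let f : ((j : ℤ) × Fin (b j)) → ((j : Function.support b) × Fin (b j)) :=
    fun σ => ⟨⟨σ.1, fun h => by have := σ.2.2; omega⟩, σ.2⟩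
  apply Finite.of_injective f
  rintro ⟨j, a⟩ ⟨j', a'⟩ h
  simp only [f, Sigma.mk.injEq] at h
  obtain ⟨h1, h⟩ := h
  have h2 : j = j' := congrArg Subtype.val h1
  subst h2
  simpa using h

section free
variable {A : Type} [CommRing A] (G : GD A) {b b' : ℤ → ℕ}

lemma lin_apply {M : Type} [AddCommGroup M] [Module A M] [Fintype ((j : ℤ) × Fin (b j))]
    (f : FreeMod A b →ₗ[A] M) (x : FreeMod A b) :
    f x = ∑ σ, x σ • f (Finsupp.single σ 1) := by
  classical
  conv_lhs => rw [← Finsupp.univ_sum_single x]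
  rw [map_sum]
  refine Finset.sum_congr rfl fun σ _ => ?_
  rw [← map_smul, Finsupp.smul_single, smul_eq_mul, mul_one]

lemma lin_apply₂ [Fintype ((j : ℤ) × Fin (b j))]
    (f : FreeMod A b →ₗ[A] FreeMod A b') (x : FreeMod A b) (τ) :
    f x τ = ∑ σ, f (Finsupp.single σ 1) τ * x σ := by
  rw [lin_apply f x, Finsupp.finsetSum_apply]
  refine Finset.sum_congr rfl fun σ _ => ?_
  rw [Finsupp.smul_apply, smul_eq_mul, mul_comm]

lemma Fgr_map [Fintype ((j : ℤ) × Fin (b j))] (f : FreeMod A b →ₗ[A] FreeMod A b')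
    (hf : ∀ σ τ, f (Finsupp.single σ 1) τ ∈ G.gr (σ.1 - τ.1)) (n : ℤ) (x : FreeMod A b)
    (hx : x ∈ Fgr G b n) : f x ∈ Fgr G b' n := by
  intro τ
  rw [lin_apply₂]
  refine AddSubgroup.sum_mem _ fun σ _ => ?_
  have := G.mul_mem _ _ _ (hf σ τ) _ (hx σ)
  convert this using 2
  ring

lemma Fgr_lift [Fintype ((j : ℤ) × Fin (b j))] (f : FreeMod A b →ₗ[A] FreeMod A b')
    (hf : ∀ σ τ, f (Finsupp.single σ 1) τ ∈ G.gr (σ.1 - τ.1)) (n : ℤ) (y : FreeMod A b)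
    (hx : f y ∈ Fgr G b' n) : ∃ z ∈ Fgr G b n, f z = f y := by
  refine ⟨Finsupp.equivFunOnFinite.symm fun σ => G.P (n - σ.1) (y σ), fun σ => ?_, ?_⟩
  · simpa using G.P_mem _ _
  · ext τ
    rw [← G.P_of_mem _ _ (hx τ), lin_apply₂, lin_apply₂ f y, map_sum]
    refine Finset.sum_congr rfl fun σ _ => ?_
    rw [G.P_mul _ _ _ (hf σ τ)]
    simp

lemma Fgr_im_iff [Fintype ((j : ℤ) × Fin (b j))] (f : FreeMod A b →ₗ[A] FreeMod A b')
    (hf : ∀ σ τ, f (Finsupp.single σ 1) τ ∈ G.gr (σ.1 - τ.1))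
    {M : Type} [AddCommGroup M] [Module A M] (g : FreeMod A b' →ₗ[A] M)
    (hfg : LinearMap.range f = LinearMap.ker g) (n : ℤ) (x : FreeMod A b') :
    x ∈ (Fgr G b n).map f.toAddMonoidHom ↔ x ∈ Fgr G b' n ∧ g x = 0 := by
  rw [AddSubgroup.mem_map]
  constructor
  · rintro ⟨y, hy, rfl⟩
    refine ⟨Fgr_map G f hf n y hy, ?_⟩
    have : f y ∈ LinearMap.ker g := hfg ▸ LinearMap.mem_range_self f y
    exact this
  · rintro ⟨h1, h2⟩
    have : x ∈ LinearMap.range f := hfg ▸ h2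
    obtain ⟨y, rfl⟩ := this
    obtain ⟨z, hz, hz2⟩ := Fgr_lift G f hf n y h1
    exact ⟨z, hz, hz2⟩

end free

section free2
variable {S : Type} [CommRing S] (C : LinCx S) {A : Type} [CommRing A] [Algebra S A] (G : GD A)
  {b b' : ℤ → ℕ}

lemma Fgr_stab (h : C.Stab G.gr) : C.Stab (Fgr G b) := by
  intro i s t n x hx σ
  have := h i s t _ _ (hx σ)
  rw [Finsupp.smul_apply]
  convert this using 2
  ring

lemma Fgr_HH [Fintype ((j : ℤ) × Fin (b j))] (i : ℕ) (n : ℤ)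
    (h : ∀ j, b j ≠ 0 → C.HH G.gr i (n - j)) : C.HH (Fgr G b) i n := by
  intro x hx hc
  have key : ∀ σ : (j : ℤ) × Fin (b j), ∃ y : C.B (i + 1) → A,
      (∀ s, y s ∈ G.gr (n - σ.1 - 1)) ∧ C.D i y = fun t => x t σ := by
    intro σ
    refine h σ.1 (fun h => by have := σ.2.2; omega) (fun t => x t σ) (fun t => hx t σ) ?_
    exact C.cyc_map (Finsupp.lapply σ : FreeMod A b →ₗ[S] A) i x hc
  choose y hy hy2 using key
  refine ⟨fun s => Finsupp.equivFunOnFinite.symm fun σ => y σ s, fun s σ => ?_, ?_⟩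
  · have := hy σ s
    rw [Finsupp.equivFunOnFinite_symm_apply_apply]
    convert this using 2
    ring
  · funext t
    ext σ
    have := congrFun (hy2 σ) t
    simp only [LinCx.D] at this ⊢
    rw [Finsupp.finsetSum_apply, ← this]
    simp

/-- generators in high degree do not exist -/
lemma gen_bound [Nonempty (C.B 0)] [Fintype ((j : ℤ) × Fin (b j))]
    {M : Type} [AddCommGroup M] [Module S M] (f : FreeMod A b →ₗ[S] M)
    (m : Ideal A) (hm : (1 : A) ∉ m) (hker : ∀ x, f x = 0 → ∀ σ, x σ ∈ m)
    (h0 : (1 : A) ∈ G.gr 0)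
    {Mg : ℤ → AddSubgroup M} (hM : ∀ n x, x ∈ Mg n ↔ ∃ y ∈ Fgr G b n, f y = x)
    (j : ℤ) (h : C.HH Mg 0 j) : b j = 0 := by
  classical
  by_contra hb
  let σ : (j : ℤ) × Fin (b j) := ⟨j, ⟨0, Nat.pos_of_ne_zero hb⟩⟩
  have he : (Finsupp.single σ 1 : FreeMod A b) ∈ Fgr G b j := by
    intro τ
    by_cases hτ : σ = τ
    · subst hτ
      simpa [σ] using h0
    · rw [Finsupp.single_eq_of_ne (Ne.symm hτ)]
      exact AddSubgroup.zero_mem _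
  obtain ⟨y, hy, hy2⟩ := h (fun _ => f (Finsupp.single σ 1))
    (fun t => (hM _ _).2 ⟨_, he, rfl⟩) trivial
  choose w hw hw2 using fun s => (hM _ _).1 (hy s)
  have h4 : (fun s => f (w s)) = y := funext hw2
  rw [← h4, LinCx.D_map] at hy2
  let t : C.B 0 := Classical.arbitrary _
  have h5 := congrFun hy2 t
  have h6 : f (Finsupp.single σ 1 - C.D 0 w t) = 0 := by
    rw [map_sub, h5, sub_self]
  have h7 := hker _ h6 σ
  apply hm
  have h8 : C.D 0 w t σ = 0 := by
    simp only [LinCx.D, Finsupp.finsetSum_apply]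
    refine Finset.sum_eq_zero fun s _ => ?_
    rw [Finsupp.smul_apply, G.neg _ _ _ (hw s σ), smul_zero]
    simp [σ]
  rw [Finsupp.sub_apply, h8] at h7
  simpa using h7

end free2

section gradings
open DirectSum
variable {k : Type} [Field k] {S : Type} [CommRing S] [Algebra k S]
    (𝒜 : ℕ → Submodule k S) [GradedAlgebra 𝒜]

noncomputable def GS : GD S where
  gr n := if 0 ≤ n then (𝒜 n.toNat).toAddSubgroup else ⊥
  P n := if 0 ≤ n then GradedRing.proj 𝒜 n.toNat else 0
  P_mem n x := by
    split_ifs with h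
    · exact (decompose 𝒜 x n.toNat).2
    · simp
  P_of_mem n x hx := by
    split_ifs at hx ⊢ with h
    · exact decompose_of_mem_same 𝒜 hx
    · simpa using hx.symm
  P_mul m n a ha x := by
    split_ifs at ha with hm
    · by_cases hn : 0 ≤ n
      · by_cases hnm : 0 ≤ n - m
        · rw [if_pos hn, if_pos hnm]
          have e : n.toNat = m.toNat + (n - m).toNat := by omega
          rw [e]
          exact coe_decompose_mul_add_of_left_mem 𝒜 ha
        · rw [if_pos hn, if_neg hnm]
          simp only [AddMonoidHom.zero_apply, mul_zero]
          exact coe_decompose_mul_of_left_mem_of_not_le 𝒜 ha (by omega)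
      · rw [if_neg hn, if_neg (by omega)]
        simp
    · have : a = 0 := by simpa using ha
      simp [this]
  neg n hn x hx := by
    rw [if_neg (by omega)] at hx
    simpa using hx
  mul_mem m n a ha x hx := by
    by_cases hm : 0 ≤ m
    · by_cases hn : 0 ≤ n
      · rw [if_pos hm] at ha
        rw [if_pos hn] at hx
        rw [if_pos (by omega)]
        have e : (m + n).toNat = m.toNat + n.toNat := by omega
        rw [e]
        exact SetLike.mul_mem_graded (A := 𝒜) ha hx
      · rw [if_neg hn] at hx
        have : x = 0 := by simpa using hx
        rw [this, mul_zero]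
        exact AddSubgroup.zero_mem _
    · rw [if_neg hm] at ha
      have : a = 0 := by simpa using ha
      rw [this, zero_mul]
      exact AddSubgroup.zero_mem _

lemma mem_GS (m : ℕ) (x : S) : x ∈ (GS 𝒜).gr m ↔ x ∈ 𝒜 m := by
  simp [GS]

variable (I : Ideal S) (hI : Ideal.IsHomogeneous 𝒜 I)

lemma GS_P_mem (hI : Ideal.IsHomogeneous 𝒜 I) (n : ℤ) (x : S) (hx : x ∈ I) : (GS 𝒜).P n x ∈ I := by
  simp only [GS]
  split_ifs
  · exact hI n.toNat hx
  · simp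

lemma GS_P_congr (hI : Ideal.IsHomogeneous 𝒜 I) (n : ℤ) (x y : S) (h : Ideal.Quotient.mk I x = Ideal.Quotient.mk I y) :
    Ideal.Quotient.mk I ((GS 𝒜).P n x) = Ideal.Quotient.mk I ((GS 𝒜).P n y) := by
  rw [Ideal.Quotient.eq] at h ⊢
  rw [← map_sub]
  exact GS_P_mem 𝒜 I hI n _ h

noncomputable def sec (x : S ⧸ I) : S := (Ideal.Quotient.mk_surjective x).choose

lemma mk_sec (x : S ⧸ I) : Ideal.Quotient.mk I (sec I x) = x :=
  (Ideal.Quotient.mk_surjective x).choose_spec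

noncomputable def PR (n : ℤ) : S ⧸ I →+ S ⧸ I where
  toFun x := Ideal.Quotient.mk I ((GS 𝒜).P n (sec I x))
  map_zero' := by
    rw [GS_P_congr 𝒜 I hI n _ 0 (by rw [mk_sec, map_zero]), map_zero, map_zero]
  map_add' x y := by
    rw [GS_P_congr 𝒜 I hI n _ (sec I x + sec I y) (by rw [map_add, mk_sec, mk_sec, mk_sec]),
      map_add, map_add]

lemma PR_mk (n : ℤ) (x : S) :
    PR 𝒜 I hI n (Ideal.Quotient.mk I x) = Ideal.Quotient.mk I ((GS 𝒜).P n x) :=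
  GS_P_congr 𝒜 I hI n _ _ (mk_sec I _)

noncomputable def GRq : GD (S ⧸ I) where
  gr n := ((GS 𝒜).gr n).map (Ideal.Quotient.mk I).toAddMonoidHom
  P := PR 𝒜 I hI
  P_mem n x := by
    obtain ⟨x, rfl⟩ := Ideal.Quotient.mk_surjective x
    rw [PR_mk]
    exact ⟨_, (GS 𝒜).P_mem n x, rfl⟩
  P_of_mem n x hx := by
    obtain ⟨x, hx, rfl⟩ := hx
    refine (PR_mk 𝒜 I hI n x).trans ?_
    rw [(GS 𝒜).P_of_mem n x hx]
    rfl
  P_mul m n a ha x := by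
    obtain ⟨a, ha, rfl⟩ := ha
    obtain ⟨x, rfl⟩ := Ideal.Quotient.mk_surjective x
    have h := PR_mk 𝒜 I hI n (a * x)
    rw [(GS 𝒜).P_mul m n a ha x, RingHom.map_mul, RingHom.map_mul, ← PR_mk 𝒜 I hI] at h
    exact h
  neg n hn x hx := by
    obtain ⟨x, hx, rfl⟩ := hx
    rw [(GS 𝒜).neg n hn x hx]
    exact map_zero _
  mul_mem m n a ha x hx := by
    obtain ⟨a, ha, rfl⟩ := ha
    obtain ⟨x, hx, rfl⟩ := hx
    exact ⟨a * x, (GS 𝒜).mul_mem m n a ha x hx, RingHom.map_mul (Ideal.Quotient.mk I) a x⟩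

end gradings

namespace MinGradedFreeRes
variable {A : Type} [CommRing A] {hom : ℕ → Set A} {M : Type} [AddCommGroup M] [Module A M]
  (res : MinGradedFreeRes A hom M)

noncomputable instance ftB (i : ℕ) : Fintype ((j : ℤ) × Fin (res.β i j)) :=
  @Fintype.ofFinite _ (sigma_finite _ (res.finβ i))

lemma entry (G : GD A) (hG : ∀ (m : ℕ) x, x ∈ hom m → x ∈ G.gr m) (i : ℕ) (σ τ) :
    res.d i (Finsupp.single σ 1) τ ∈ G.gr (σ.1 - τ.1) := by
  obtain ⟨j, a⟩ := σ
  obtain ⟨j', a'⟩ := τ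
  rcases res.graded i j a j' a' with h | ⟨m, hm, h⟩
  · rw [h]; exact AddSubgroup.zero_mem _
  · have := hG m _ h
    rw [hm] at this
    exact this

lemma entry_max (m : Ideal A) (hm : ∀ n : ℕ, 1 ≤ n → ∀ x ∈ hom n, x ∈ m) (i : ℕ) (σ τ) :
    res.d i (Finsupp.single σ 1) τ ∈ m := by
  obtain ⟨j, a⟩ := σ
  obtain ⟨j', a'⟩ := τ
  by_cases h0 : res.d i (Finsupp.single ⟨j, a⟩ 1) ⟨j', a'⟩ = 0
  · rw [h0]; exact m.zero_mem
  have := res.minimal i j a j' a' h0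
  rcases res.graded i j a j' a' with h | ⟨n, hn, h⟩
  · exact absurd h h0
  · exact hm n (by omega) _ h

lemma ker_max (m : Ideal A) (hm : ∀ n : ℕ, 1 ≤ n → ∀ x ∈ hom n, x ∈ m) (i : ℕ)
    (x : FreeMod A (res.β (i + 1))) (hx : res.d i x = 0) (σ) : x σ ∈ m := by
  have : x ∈ LinearMap.range (res.d (i + 1)) := by
    rw [res.exact]; exact hx
  obtain ⟨y, rfl⟩ := this
  rw [lin_apply₂]
  exact m.sum_mem fun τ _ => m.mul_mem_right _ (res.entry_max m hm _ _ _)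

lemma lower (m : Ideal A) (hm : ∀ n : ℕ, 1 ≤ n → ∀ x ∈ hom n, x ∈ m) (h1 : (1 : A) ∉ m)
    (h0 : ∀ j : ℤ, res.β 0 j = if j = 0 then 1 else 0) (i : ℕ) :
    ∀ j, res.β i j ≠ 0 → (i : ℤ) ≤ j := by
  induction i with
  | zero =>
    intro j hj
    rw [h0] at hj
    by_cases h : j = 0
    · simp [h]
    · simp [h] at hj
  | succ i ih =>
    intro j hj
    let a : Fin (res.β (i + 1) j) := ⟨0, Nat.pos_of_ne_zero hj⟩
    by_cases h : res.d i (Finsupp.single ⟨j, a⟩ 1) = 0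
    · have := res.ker_max m hm i _ h ⟨j, a⟩
      rw [Finsupp.single_eq_same] at this
      exact absurd this h1
    · obtain ⟨⟨j', a'⟩, h'⟩ := Finsupp.ne_iff.1 h
      have h2 := res.minimal i j a j' a' h'
      have h3 := ih j' (fun h => by have := a'.2; omega)
      push_cast
      omega

/-- the linear complex -/
noncomputable def cx : LinCx A where
  B i := (j : ℤ) × Fin (res.β i j)
  ft i := res.ftB i
  a i s t := res.d i (Finsupp.single s 1) t
  dd i s u := by
    have h : res.d (i + 1) (Finsupp.single s 1) ∈ LinearMap.ker (res.d i) := by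
      rw [← res.exact]; exact LinearMap.mem_range_self _ _
    have h2 : res.d i (res.d (i + 1) (Finsupp.single s 1)) u = 0 := by
      rw [LinearMap.mem_ker.1 h]; rfl
    rw [lin_apply₂] at h2
    rw [← h2]
    exact Finset.sum_congr rfl fun t _ => mul_comm _ _

lemma cx_a_mem (G : GD A) (hG : ∀ (m : ℕ) x, x ∈ hom m → x ∈ G.gr m)
    (hlin : ∀ (i : ℕ) (j : ℤ), res.β i j ≠ 0 → j = (i : ℤ)) (i s t) : res.cx.a i s t ∈ G.gr 1 := by
  have := res.entry G hG i s t
  have h1 : s.1 = ((i + 1 : ℕ) : ℤ) := hlin _ _ (fun h => by have := s.2.2; omega)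
  have h2 : t.1 = (i : ℤ) := hlin _ _ (fun h => by have := t.2.2; omega)
  have e : s.1 - t.1 = 1 := by rw [h1, h2]; push_cast; ring
  rw [e] at this
  exact this

lemma cx_D (i : ℕ) (y : FreeMod A (res.β (i + 1))) :
    res.cx.D i (fun s => y s) = fun t => res.d i y t := by
  funext t
  exact (lin_apply₂ (res.d i) y t).symm

lemma cx_HH (G : GD A) (hG : ∀ (m : ℕ) x, x ∈ hom m → x ∈ G.gr m)
    (hlin : ∀ (i : ℕ) (j : ℤ), res.β i j ≠ 0 → j = (i : ℤ))
    (hM : ∀ n, 0 < n → ∀ x ∈ G.gr n, ∀ c : M, x • c = 0)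
    (i : ℕ) (n : ℤ) (h : 1 ≤ i ∨ 0 < n) : res.cx.HH G.gr i n := by
  have hdeg : ∀ i (s : (j : ℤ) × Fin (res.β i j)), s.1 = (i : ℤ) :=
    fun i s => hlin _ _ (fun h => by have := s.2.2; omega)
  intro x hx hc
  let x' : FreeMod A (res.β i) := Finsupp.equivFunOnFinite.symm x
  have hx' : (fun s => x' s) = x := by funext s; rfl
  have hmem : x' ∈ Fgr G (res.β i) (n + i) := by
    intro σ
    rw [hdeg, add_sub_cancel_right]
    exact hx σ
  have hr : x' ∈ LinearMap.range (res.d i) := by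
    cases i with
    | zero =>
      rw [res.exact₀, LinearMap.mem_ker, lin_apply]
      exact Finset.sum_eq_zero fun σ _ => hM n (by omega) _ (hx σ) _
    | succ i =>
      rw [res.exact, LinearMap.mem_ker]
      have hc : res.cx.D i x = 0 := hc
      rw [← hx'] at hc
      have hc2 := (res.cx_D i x').symm.trans hc
      ext t
      exact congrFun hc2 t
  obtain ⟨y, hy⟩ := hr
  rw [← hy] at hmem
  obtain ⟨z, hz, hz2⟩ := Fgr_lift G (res.d i) (res.entry G hG i) _ _ hmem
  refine ⟨fun s => z s, fun s => ?_, ?_⟩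
  · have := hz s
    have e : n + (i : ℤ) - s.1 = n - 1 := by rw [hdeg (i + 1) s]; push_cast; ring
    rw [e] at this
    exact this
  · refine (res.cx_D i z).trans ?_
    rw [hz2, hy]
    exact hx'

end MinGradedFreeRes

section chain
variable {S : Type} [CommRing S] (C : LinCx S) {hom : ℕ → Set S}

lemma quot_HH (I : Ideal S) (G : GD S) (hG : ∀ (m : ℕ) x, x ∈ hom m → x ∈ G.gr m)
    (hstab : C.Stab G.gr) (hS : ∀ i n, (1 ≤ i ∨ 0 < n) → C.HH G.gr i n)
    (Rres : MinGradedFreeRes S hom (S ⧸ I))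
    (h0 : ∀ j : ℤ, Rres.β 0 j = if j = 0 then 1 else 0)
    (hreg : ∀ i : ℕ, 1 ≤ i → ∀ j : ℤ, Rres.β i j ≠ 0 → j ≤ (i : ℤ) + 1)
    (gq : ℤ → AddSubgroup (S ⧸ I))
    (hgq : ∀ n x, x ∈ gq n ↔ ∃ y ∈ G.gr n, Ideal.Quotient.mk I y = x)
    (i : ℕ) (n : ℤ) (hn : 1 < n) : C.HH gq i n := by
  have T : ∀ (i q : ℕ) (n : ℤ), (q : ℤ) + 2 < n →
      C.HH (fun n => (Fgr G (Rres.β (q + 1)) n).map (Rres.d q).toAddMonoidHom) i n := by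
    intro i
    induction i with
    | zero =>
      intro q n hn
      refine C.HH_zero (F := Fgr G (Rres.β (q + 1))) (Rres.d q) (fun n x => Iff.rfl) n ?_
      refine Fgr_HH C G 0 n fun j hj => hS _ _ (Or.inr ?_)
      have := hreg (q + 1) (by omega) j hj
      push_cast at this
      omega
    | succ i ih =>
      intro q n hn
      refine C.HH_coker (F := Fgr G (Rres.β (q + 1))) (Rres.d q) (Fgr_stab C G hstab)
        (fun n x => Iff.rfl)
        (fun n x => Fgr_im_iff G (Rres.d (q + 1)) (Rres.entry G hG _) (Rres.d q)
          (Rres.exact q) n x) i n ?_ (ih (q + 1) (n + 1) (by push_cast; omega))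
      exact Fgr_HH C G _ n fun j hj => hS _ _ (Or.inl (by omega))
  have T0 : C.HH (fun n => (Fgr G (Rres.β 0) n).map Rres.aug.toAddMonoidHom) i n := by
    cases i with
    | zero =>
      refine C.HH_zero (F := Fgr G (Rres.β 0)) Rres.aug (fun n x => Iff.rfl) n ?_
      refine Fgr_HH C G 0 n fun j hj => hS _ _ (Or.inr ?_)
      rw [h0] at hj
      have : j = 0 := by by_contra h; simp [h] at hj
      omega
    | succ i =>
      refine C.HH_coker (F := Fgr G (Rres.β 0)) Rres.aug (Fgr_stab C G hstab)
        (fun n x => Iff.rfl)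
        (fun n x => Fgr_im_iff G (Rres.d 0) (Rres.entry G hG _) Rres.aug
          Rres.exact₀ n x) i n ?_ (T i 0 (n + 1) (by push_cast; omega))
      exact Fgr_HH C G _ n fun j hj => hS _ _ (Or.inl (by omega))
  have hb : Rres.β 0 0 = 1 := by rw [h0]; simp
  let σ₀ : (j : ℤ) × Fin (Rres.β 0 j) := ⟨0, ⟨0, by omega⟩⟩
  have huniq : ∀ σ : (j : ℤ) × Fin (Rres.β 0 j), σ = σ₀ := by
    rintro ⟨j, a⟩
    have hj : j = 0 := by
      by_contra h
      have h2 := a.2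
      have h3 := h0 j
      rw [if_neg h] at h3
      omega
    subst hj
    have : a = ⟨0, by omega⟩ := by ext; have := a.2; show (a : ℕ) = 0; omega
    rw [this]
  have haug : ∀ z, Rres.aug z = z σ₀ • Rres.aug (Finsupp.single σ₀ 1) := by
    intro z
    rw [lin_apply]
    exact Finset.sum_eq_single σ₀ (fun σ _ h => absurd (huniq σ) h) (fun h => absurd (Finset.mem_univ _) h)
  set u := Rres.aug (Finsupp.single σ₀ 1) with hu
  obtain ⟨z, hz⟩ := Rres.augSurj 1
  have hunit : Ideal.Quotient.mk I (z σ₀) * u = 1 := by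
    rw [← hz, haug z, Algebra.smul_def]; rfl
  refine C.HH_inj (LinearMap.mulLeft S u) ?_ ?_ i n T0
  · intro x y hxy
    have hxy : u * x = u * y := hxy
    have := congrArg (fun w => Ideal.Quotient.mk I (z σ₀) * w) hxy
    simpa only [← mul_assoc, hunit, one_mul] using this
  · intro n x
    constructor
    · rintro ⟨w, hw, rfl⟩
      refine ⟨Ideal.Quotient.mk I (w σ₀), (hgq _ _).2 ⟨w σ₀, ?_, rfl⟩, ?_⟩
      · have := hw σ₀
        simpa [σ₀] using this
      · show u * _ = Rres.aug w
        rw [haug w, Algebra.smul_def, mul_comm]; rfl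
    · rintro ⟨y, hy, rfl⟩
      obtain ⟨y, hy', rfl⟩ := (hgq _ _).1 hy
      refine ⟨Finsupp.single σ₀ y, fun σ => ?_, ?_⟩
      · rw [huniq σ, Finsupp.single_eq_same]
        simpa [σ₀] using hy'
      · show Rres.aug _ = u * _
        rw [haug, Finsupp.single_eq_same, Algebra.smul_def, mul_comm]; rfl

lemma res_bound {A : Type} [CommRing A] [Algebra S A] {homA : ℕ → Set A} (G : GD A)
    (hG : ∀ (m : ℕ) x, x ∈ homA m → x ∈ G.gr m) [Nonempty (C.B 0)]
    (hstab : C.Stab G.gr) (hA : ∀ i n, 1 < n → C.HH G.gr i n)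
    {κ : Type} [AddCommGroup κ] [Module S κ] [Module A κ] [IsScalarTower S A κ]
    (hκ : ∀ n, 0 < n → ∀ x ∈ G.gr n, ∀ c : κ, x • c = 0)
    (h1 : (1 : A) ∈ G.gr 0)
    (m : Ideal A) (hm : ∀ n : ℕ, 1 ≤ n → ∀ x ∈ homA n, x ∈ m) (hm1 : (1 : A) ∉ m)
    (res : MinGradedFreeRes A homA κ)
    (h0 : ∀ j : ℤ, res.β 0 j = if j = 0 then 1 else 0) (p : ℕ) :
    (∀ i n, (p : ℤ) + 1 < n →
      C.HH (fun n => (Fgr G (res.β (p + 1)) n).map (res.d p).toAddMonoidHom) i n) ∧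
    (∀ j, res.β (p + 1) j ≠ 0 → j ≤ (p : ℤ) + 1) := by
  have B : ∀ p : ℕ, (∀ i n, (p : ℤ) + 1 < n →
      C.HH (fun n => (Fgr G (res.β (p + 1)) n).map (res.d p).toAddMonoidHom) i n) →
      (∀ j, res.β (p + 1) j ≠ 0 → j ≤ (p : ℤ) + 1) := by
    intro p hp j hj
    by_contra h
    exact hj (gen_bound C G ((res.d p).restrictScalars S) m hm1
      (fun x hx σ => res.ker_max m hm p x hx σ) h1 (fun n x => Iff.rfl) j (hp 0 j (by omega)))
  induction p with
  | zero =>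
    refine (fun h => ⟨h, B 0 h⟩) ?_
    intro i n hn
    refine C.HH_ker (F := Fgr G (res.β 0))
      (M := fun n => (Fgr G (res.β 0) n).map res.aug.toAddMonoidHom)
      (res.aug.restrictScalars S) (Fgr_stab C G hstab) (fun n x => Iff.rfl)
      (fun n x => Fgr_im_iff G (res.d 0) (res.entry G hG _) res.aug res.exact₀ n x) i n ?_ ?_
    · refine Fgr_HH C G i n fun j hj => hA _ _ ?_
      rw [h0] at hj
      have : j = 0 := by by_contra h; simp [h] at hj
      push_cast at hn
      omega
    · intro x hx _
      refine ⟨0, fun s => AddSubgroup.zero_mem _, ?_⟩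
      funext t
      obtain ⟨w, hw, hw2⟩ := hx t
      rw [← hw2]
      show _ = res.aug w
      rw [lin_apply, Finset.sum_eq_zero]
      · simp [LinCx.D]
      · intro σ _
        refine hκ _ ?_ _ (hw σ) _
        have h2 := σ.2.2
        have h3 := h0 σ.1
        have : σ.1 = 0 := by
          by_contra h
          rw [if_neg h] at h3
          omega
        push_cast at hn
        omega
  | succ p ih =>
    refine (fun h => ⟨h, B (p + 1) h⟩) ?_
    intro i n hn
    push_cast at hn
    refine C.HH_ker (F := Fgr G (res.β (p + 1)))
      (M := fun n => (Fgr G (res.β (p + 1)) n).map (res.d p).toAddMonoidHom)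
      ((res.d p).restrictScalars S) (Fgr_stab C G hstab) (fun n x => Iff.rfl)
      (fun n x => Fgr_im_iff G (res.d (p + 1)) (res.entry G hG _) (res.d p) (res.exact p) n x)
      i n ?_ (ih.1 _ _ (by omega))
    refine Fgr_HH C G i n fun j hj => hA _ _ ?_
    have := ih.2 j hj
    omega

end chain

/-- Let `S` be a standard graded Koszul algebra over `k` and `R = S/I`.
If `reg^S(R) = 1` (i.e. `t_i^S(R) ≤ i + 1` for all `i ≥ 1`, with the value `1` attained),
then `R` is a Koszul algebra, i.e. `reg^R(k) = 0`: `Tor_i^R(k,k)` is concentrated in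
degree `i`. -/
theorem koszul_of_reg_eq_one
    (k : Type) [Field k] (S : Type) [CommRing S] [Algebra k S]
    (𝒜 : ℕ → Submodule k S) [GradedAlgebra 𝒜]
    (hstd : ∀ m, 𝒜 (m + 1) = 𝒜 m * 𝒜 1)
    (ε : S →ₐ[k] k) (hε : ∀ m, 1 ≤ m → ∀ x ∈ 𝒜 m, ε x = 0)
    (I : Ideal S) (hI : Ideal.IsHomogeneous 𝒜 I)
    (hIε : ∀ a ∈ I, ε a = 0) :
    letI : Module S k := Module.compHom k ε.toRingHom
    letI : Module (S ⧸ I) k :=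
      Module.compHom k (Ideal.Quotient.lift I ε.toRingHom hIε)
    ∀ (Kres : MinGradedFreeRes S (fun m => (𝒜 m : Set S)) k),
      (∀ (i : ℕ) (j : ℤ), Kres.β i j ≠ 0 → j = (i : ℤ)) →
    ∀ (Rres : MinGradedFreeRes S (fun m => (𝒜 m : Set S)) (S ⧸ I)),
      (∀ j : ℤ, Rres.β 0 j = if j = 0 then 1 else 0) →
    ∀ (kres : MinGradedFreeRes (S ⧸ I)
        (fun m => (Ideal.Quotient.mk I) '' (𝒜 m : Set S)) k),
      (∀ j : ℤ, kres.β 0 j = if j = 0 then 1 else 0) →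
      (∀ i : ℕ, 1 ≤ i → ∀ j : ℤ, Rres.β i j ≠ 0 → j ≤ (i : ℤ) + 1) →
      (∃ (i : ℕ) (j : ℤ), Rres.β i j ≠ 0 ∧ j = (i : ℤ) + 1) →
    ∀ (i : ℕ) (j : ℤ), kres.β i j ≠ 0 → j = (i : ℤ) := by
  letI mS : Module S k := Module.compHom k ε.toRingHom
  letI mR : Module (S ⧸ I) k :=
    Module.compHom k (Ideal.Quotient.lift I ε.toRingHom hIε)
  intro Kres hlin Rres hR0 kres hk0 hreg _ i j hj
  have : IsScalarTower S (S ⧸ I) k := ⟨fun s r c => by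
    obtain ⟨r, rfl⟩ := Ideal.Quotient.mk_surjective r
    show ε (s * r) * c = ε s * (ε r * c)
    rw [map_mul, mul_assoc]⟩
  have hG : ∀ (m : ℕ) x, x ∈ (𝒜 m : Set S) → x ∈ (GS 𝒜).gr m :=
    fun m x hx => (mem_GS 𝒜 m x).2 hx
  have hεG : ∀ n, 0 < n → ∀ x ∈ (GS 𝒜).gr n, ε x = 0 := by
    intro n hn x hx
    lift n to ℕ using hn.le
    exact hε n (by omega) x ((mem_GS 𝒜 n x).1 hx)
  have ha := Kres.cx_a_mem (GS 𝒜) hG hlin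
  have hstab : Kres.cx.Stab (GS 𝒜).gr := by
    intro i s t n x hx
    rw [add_comm]
    exact (GS 𝒜).mul_mem _ _ _ (ha i s t) _ hx
  have hS := Kres.cx_HH (GS 𝒜) hG hlin (by
    intro n hn x hx c
    show ε x * c = 0
    rw [hεG n hn x hx, zero_mul])
  have hA := quot_HH Kres.cx I (GS 𝒜) hG hstab hS Rres hR0 hreg (GRq 𝒜 I hI).gr
    (fun n x => Iff.rfl)
  have hstabR : Kres.cx.Stab (GRq 𝒜 I hI).gr := by
    intro i s t n x hx
    obtain ⟨x, hx, rfl⟩ := hx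
    exact ⟨_, hstab i s t n x hx, rfl⟩
  have hne : Nonempty (Kres.cx.B 0) := by
    by_contra h
    have hE : IsEmpty ((j : ℤ) × Fin (Kres.β 0 j)) := not_nonempty_iff.1 h
    obtain ⟨z, hz⟩ := Kres.augSurj (1 : k)
    have : z = 0 := Subsingleton.elim _ _
    rw [this, map_zero] at hz
    exact zero_ne_one hz
  let m : Ideal (S ⧸ I) := RingHom.ker (Ideal.Quotient.lift I ε.toRingHom hIε)
  have hm1 : (1 : S ⧸ I) ∉ m := by
    intro h
    have h := RingHom.mem_ker.1 h
    rw [map_one] at h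
    exact one_ne_zero h
  have hm : ∀ n : ℕ, 1 ≤ n → ∀ x ∈ (Ideal.Quotient.mk I) '' (𝒜 n : Set S), x ∈ m := by
    rintro n hn _ ⟨x, hx, rfl⟩
    exact hε n hn x hx
  have hlow := kres.lower m hm hm1 hk0 i j hj
  refine le_antisymm ?_ hlow
  cases i with
  | zero =>
    rw [hk0] at hj
    have : j = 0 := by by_contra h; simp [h] at hj
    simp [this]
  | succ p =>
    have := (res_bound Kres.cx (GRq 𝒜 I hI)
      (homA := fun m => (Ideal.Quotient.mk I) '' (𝒜 m : Set S))
      (by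
        rintro m _ ⟨x, hx, rfl⟩
        exact ⟨x, hG m x hx, rfl⟩) hstabR hA (κ := k) (by
        rintro n hn _ ⟨x, hx, rfl⟩ c
        show ε x * c = 0
        rw [hεG n hn x hx, zero_mul])
      ⟨1, (mem_GS 𝒜 0 1).2 SetLike.GradedOne.one_mem, rfl⟩ m hm hm1 kres hk0 p).2 j hj
    push_cast
    exact this
end

section
/- Let S be a standard graded Koszul algebra over k and R = S/I satisfying reg_{n+1}^R(k) ≤ 1 for some n ≥ 1 and the Green–Lazarsfeld condition N_q over S for some q ≥ 1 (i.e. t_i^S(R) = i + 1 for 1 ≤ i ≤ q). Then t_i^S(R) ≤ 2i − q + 1 for q + 1 ≤ i ≤ n. -/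
namespace TLe

/-- abstract chase -/
theorem chase (X : ℕ → ℕ → Type) [∀ a b, AddCommGroup (X a b)]
    (d1 : ∀ a b, X (a+1) b →+ X a b) (d2 : ∀ a b, X a (b+1) →+ X a b)
    (comm : ∀ a b x, d1 a b (d2 (a+1) b x) = d2 a b (d1 a (b+1) x))
    (sq1 : ∀ a b x, d1 a b (d1 (a+1) b x) = 0)
    (sq2 : ∀ a b x, d2 a b (d2 a (b+1) x) = 0)
    (θ η : ∀ a b, X a b →+ X a b)
    (θ1 : ∀ a b x, θ a b (d1 a b x) = d1 a b (θ (a+1) b x))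
    (θ2 : ∀ a b x, θ a b (d2 a b x) = d2 a b (θ a (b+1) x))
    (η1 : ∀ a b x, η a b (d1 a b x) = d1 a b (η (a+1) b x))
    (η2 : ∀ a b x, η a b (d2 a b x) = d2 a b (η a (b+1) x))
    (θη : ∀ a b x, θ a b (η a b x) = θ a b x)
    (ηθ : ∀ a b x, η a b (θ a b x) = θ a b x)
    (N : ℕ)
    (E : ∀ a b, a + 1 + b = N → ∀ y : X (a+1) b, d1 a b y = 0 → ∃ w, d1 (a+1) b w = η _ _ y)
    (P : ∀ a b, a + 1 + b = N → ∀ c : X (a+1) (b+1), d2 _ _ c = 0 →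
      ∃ v, d2 (a+1) (b+1) v = η _ _ c)
    (base : ∀ (w : X N 1) (w' : X (N+1) 0), d1 _ _ w' = d2 _ _ w →
      ∃ v : X (N+1) 1, d2 _ _ (d1 _ _ v) = d2 _ _ (θ _ _ w)) :
    ∀ b a, a + b = N → ∀ (w : X a (b+1)) (w' : X (a+1) b), d1 _ _ w' = d2 _ _ w →
      ∃ v : X (a+1) (b+1), d2 _ _ (d1 _ _ v) = d2 _ _ (θ _ _ w) := by
  intro b
  induction b with
  | zero => 
    intro a h
    obtain rfl : a = N := by omega
    exact base
  | succ b ih =>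
    intro a h w w' hw
    obtain ⟨w'', h''⟩ := E a b (by omega) (d2 _ _ w') (by rw [comm, hw, sq2])
    rw [η2] at h''
    obtain ⟨v', hv'⟩ := ih (a+1) (by omega) _ w'' h''
    rw [θη] at hv'
    obtain ⟨v, hv⟩ := P a b (by omega) (θ _ _ w' - d1 _ _ v') (by rw [map_sub, hv', sub_self])
    refine ⟨v, ?_⟩
    rw [← comm, hv, map_sub, map_sub, ηθ, η1, sq1, sub_zero, ← θ1, hw, θ2]

structure GC (T : Type) [CommRing T] (p : ℤ → T →+ T) where
  J : ℕ → Type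
  fin : ∀ i, Fintype (J i)
  deg : ∀ i, J i → ℤ
  D : ∀ i, J (i+1) → J i → T
  sq : ∀ i g h, ∑ g', D (i+1) g g' * D i g' h = 0
  hom : ∀ i g h e y, p (e + (deg (i+1) g - deg i h)) (D i g h * y) = D i g h * p e y

attribute [instance] GC.fin

section
variable {T : Type} [CommRing T] {p : ℤ → T →+ T}

/-- one-dimensional differential -/
def GC.δ (P : GC T p) (i : ℕ) : (P.J (i+1) → T) →ₗ[T] (P.J i → T) where
  toFun x h := ∑ g, P.D i g h * x g
  map_add' x y := by ext h; simp [mul_add, Finset.sum_add_distrib]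
  map_smul' r x := by ext h; simp [Finset.mul_sum, mul_left_comm]

theorem GC.δ_apply (P : GC T p) (i : ℕ) (x h) : P.δ i x h = ∑ g, P.D i g h * x g := rfl

theorem GC.δδ (P : GC T p) (i : ℕ) (x) : P.δ i (P.δ (i+1) x) = 0 := by
  ext h
  simp only [GC.δ_apply, Finset.mul_sum, Pi.zero_apply]
  rw [Finset.sum_comm]
  refine Finset.sum_eq_zero fun g _ => ?_
  have := congrArg (· * x g) (P.sq i g h)
  simp only [zero_mul, Finset.sum_mul] at this
  rw [← this]
  exact Finset.sum_congr rfl fun g' _ => by ring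

/-- one-dimensional projection -/
def GC.pr (P : GC T p) (i : ℕ) (d : ℤ) : (P.J i → T) →+ (P.J i → T) where
  toFun x h := p (d - P.deg i h) (x h)
  map_zero' := by ext; simp
  map_add' x y := by ext; simp

theorem GC.pr_apply (P : GC T p) (i : ℕ) (d x h) : P.pr i d x h = p (d - P.deg i h) (x h) := rfl

theorem GC.pr_δ (P : GC T p) (i : ℕ) (d x) : P.pr i d (P.δ i x) = P.δ i (P.pr (i+1) d x) := by
  ext h
  simp only [GC.δ_apply, GC.pr_apply, map_sum]
  refine Finset.sum_congr rfl fun g _ => ?_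
  rw [← P.hom]; congr 1; congr 1; ring

abbrev XX (P Q : GC T p) (a b : ℕ) : Type := P.J a → Q.J b → T

def D2 (P Q : GC T p) (a b : ℕ) : XX P Q a (b+1) →+ XX P Q a b where
  toFun x g := Q.δ b (x g)
  map_zero' := by ext; simp
  map_add' x y := by ext; simp

def D1 (P Q : GC T p) (a b : ℕ) : XX P Q (a+1) b →+ XX P Q a b where
  toFun x g h := P.δ a (fun g' => x g' h) g
  map_zero' := by 
    ext g h
    exact congrFun (map_zero (P.δ a)) g
  map_add' x y := by
    ext g h
    exact congrFun (map_add (P.δ a) (fun g' => x g' h) (fun g' => y g' h)) g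

def PR (P Q : GC T p) (d : ℤ) (a b : ℕ) : XX P Q a b →+ XX P Q a b where
  toFun x g := Q.pr b (d - P.deg a g) (x g)
  map_zero' := by ext; simp
  map_add' x y := by ext; simp

def ML (P Q : GC T p) (r : T) (a b : ℕ) : XX P Q a b →+ XX P Q a b where
  toFun x := r • x
  map_zero' := by ext; simp
  map_add' x y := by ext; simp [mul_add]

variable (P Q : GC T p)

theorem D2_apply (a b x g) : D2 P Q a b x g = Q.δ b (x g) := rfl
theorem D1_apply (a b x g h) : D1 P Q a b x g h = P.δ a (fun g' => x g' h) g := rfl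
theorem PR_apply (d a b x g) : PR P Q d a b x g = Q.pr b (d - P.deg a g) (x g) := rfl
theorem PR_apply' (d a b x g h) : PR P Q d a b x g h = P.pr a (d - Q.deg b h) (fun g' => x g' h) g := by
  simp only [PR_apply, GC.pr_apply]; congr 2; ring
theorem ML_apply (r a b x) : ML P Q r a b x = r • x := rfl

theorem D1_swap (a b) (x : XX P Q (a+1) b) (h) :
    (fun g => D1 P Q a b x g h) = P.δ a (fun g' => x g' h) := rfl

theorem DD_comm (a b x) : D1 P Q a b (D2 P Q (a+1) b x) = D2 P Q a b (D1 P Q a (b+1) x) := by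
  ext g h
  simp only [D1_apply, D2_apply, GC.δ_apply, Finset.mul_sum]
  rw [Finset.sum_comm]
  refine Finset.sum_congr rfl fun _ _ => Finset.sum_congr rfl fun _ _ => by ring

theorem D1_sq (a b x) : D1 P Q a b (D1 P Q (a+1) b x) = 0 := by
  ext g h
  rw [D1_apply, D1_swap, P.δδ]; rfl

theorem D2_sq (a b x) : D2 P Q a b (D2 P Q a (b+1) x) = 0 := by
  ext g h
  rw [D2_apply, D2_apply, Q.δδ]; rfl

theorem PR_D2 (d a b x) : PR P Q d a b (D2 P Q a b x) = D2 P Q a b (PR P Q d a (b+1) x) := by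
  ext g h
  rw [PR_apply, D2_apply, D2_apply, Q.pr_δ]; rfl

theorem PR_D1 (d a b x) : PR P Q d a b (D1 P Q a b x) = D1 P Q a b (PR P Q d (a+1) b x) := by
  ext g h
  rw [PR_apply', D1_swap, P.pr_δ, D1_apply]
  refine congrFun (congrArg (P.δ a) ?_) g
  ext g'
  rw [PR_apply']

theorem PR_PR (hpp : ∀ e y, p e (p e y) = p e y) (d a b x) :
    PR P Q d a b (PR P Q d a b x) = PR P Q d a b x := by
  ext g h
  simp [PR_apply, GC.pr_apply, hpp]

theorem ML_D2 (r a b x) : ML P Q r a b (D2 P Q a b x) = D2 P Q a b (ML P Q r a (b+1) x) := by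
  ext g h
  simp [ML_apply, D2_apply]

theorem ML_D1 (r a b x) : ML P Q r a b (D1 P Q a b x) = D1 P Q a b (ML P Q r (a+1) b x) := by
  ext g h
  simp [ML_apply, D1_apply, GC.δ_apply, Finset.mul_sum, mul_left_comm]

def GC.Ex (P : GC T p) : Prop := ∀ i x, P.δ i x = 0 → ∃ y, P.δ (i+1) y = x

theorem D1_ex (hP : P.Ex) (a b) (x : XX P Q (a+1) b) (hx : D1 P Q a b x = 0) :
    ∃ y, D1 P Q (a+1) b y = x := by
  have : ∀ h, ∃ y, P.δ (a+1) y = fun g => x g h := fun h => hP a _ (by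
    rw [← D1_swap, hx]; rfl)
  choose y hy using this
  refine ⟨fun g h => y h g, ?_⟩
  ext g h
  rw [D1_apply]
  exact congrFun (hy h) g

/-- pointwise lifting along the second differential -/
theorem D2_lift (a b) (x : XX P Q a b) (hx : ∀ g, ∃ y, Q.δ b y = x g) :
    ∃ y, D2 P Q a b y = x := by
  choose y hy using hx
  exact ⟨y, funext hy⟩

theorem D1_lift (a b) (x : XX P Q a b) (hx : ∀ h, ∃ y, P.δ a y = fun g => x g h) :
    ∃ y, D1 P Q a b y = x := by
  choose y hy using hx
  refine ⟨fun g h => y h g, ?_⟩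
  ext g h
  rw [D1_apply]
  exact congrFun (hy h) g

theorem D2_ex (hQ : Q.Ex) (a b) (x : XX P Q a (b+1)) (hx : D2 P Q a b x = 0) :
    ∃ y, D2 P Q a (b+1) y = x :=
  D2_lift P Q _ _ x fun g => hQ b _ (by rw [← D2_apply, hx]; rfl)


/-- vanishing of the homology in homological degree `b + 1` and internal degree `d` -/
def HV (Q : GC T p) (b : ℕ) (d : ℤ) : Prop :=
  ∀ z : Q.J (b+1) → T, Q.δ b z = 0 → ∃ y, Q.δ (b+1) y = Q.pr (b+1) d z

theorem L24 (hpp : ∀ e y, p e (p e y) = p e y) {k : Type} [Field k] (ε : T →+* k)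
    (hp1 : p 0 1 = 1) (hP : P.Ex) (hmin : ∀ i g h, ε (P.D i g h) = 0)
    (c : Q.J 0 → k) (AQ1 : ∀ x : Q.J 0 → T, (∀ h, ε (x h) = 0) → ∃ y, Q.δ 0 y = x)
    (AQ2 : ∀ y, ∑ h, ε (Q.δ 0 y h) * c h = 0) (h0 : Q.J 0) (hc : c h0 ≠ 0)
    (hd0 : Q.deg 0 h0 = 0) (j : ℕ) (d : ℤ) (g : P.J (j+1)) (hg : P.deg (j+1) g = d)
    (E : ∀ b a, b + 1 + a = j → ∀ y : XX Q P (b+1) a, D1 Q P b a y = 0 →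
      ∃ w, D1 Q P (b+1) a w = PR Q P d _ _ y)
    (base : ∀ (w : XX Q P j 1) (w' : XX Q P (j+1) 0), D1 Q P _ _ w' = D2 Q P _ _ w →
      ∃ v : XX Q P (j+1) 1, D2 Q P _ _ (D1 Q P _ _ v) = D2 Q P _ _ (PR Q P d _ _ w)) :
    False := by
  classical
  let w : XX Q P 0 (j+1) := fun h g' => if h = h0 ∧ g' = g then 1 else 0
  obtain ⟨w', hw'⟩ := D1_lift Q P 0 j (D2 Q P 0 j w) (fun g' => AQ1 _ fun h => by
    simp [D2_apply, GC.δ_apply, map_sum, hmin])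
  obtain ⟨v, hv⟩ := chase (fun b a => XX Q P b a) (D1 Q P) (D2 Q P) (DD_comm Q P)
    (D1_sq Q P) (D2_sq Q P) (PR Q P d) (PR Q P d) (PR_D1 Q P d) (PR_D2 Q P d)
    (PR_D1 Q P d) (PR_D2 Q P d) (PR_PR Q P hpp d) (PR_PR Q P hpp d) j E
    (fun b a _ c hc => by
      obtain ⟨v, rfl⟩ := D2_ex Q P hP _ _ c hc
      exact ⟨_, (PR_D2 Q P d _ _ v).symm⟩) base j 0 (by omega) w w' hw'
  obtain ⟨u, hu⟩ := D2_ex Q P hP _ _ (PR Q P d _ _ w - D1 Q P _ _ v)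
    (by rw [map_sub, hv, sub_self])
  have e1 : ∀ h, ε (PR Q P d _ _ w h g) = ε (D1 Q P _ _ v h g) := by
    intro h
    have := congrArg ε (congrFun (congrFun hu h) g)
    simp only [D2_apply, GC.δ_apply, map_sum, map_mul, hmin, zero_mul, Finset.sum_const_zero,
      Pi.sub_apply, map_sub] at this
    exact (sub_eq_zero.1 this.symm)
  have e2 := AQ2 (fun h => v h g)
  have e3 : ∀ h, ε (Q.δ 0 (fun h => v h g) h) = if h = h0 then 1 else 0 := by
    intro h
    rw [← D1_apply, ← e1, PR_apply, GC.pr_apply]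
    by_cases hh : h = h0
    · subst hh
      simp [w, hd0, hg, hp1]
    · simp [w, hh]
  simp [e3] at e2
  exact hc e2

theorem L1gen (hP : P.Ex) (hQ : Q.Ex) (θ : ∀ a b, XX P Q a b →+ XX P Q a b)
    (θ1 : ∀ a b x, θ a b (D1 P Q a b x) = D1 P Q a b (θ (a+1) b x))
    (θ2 : ∀ a b x, θ a b (D2 P Q a b x) = D2 P Q a b (θ a (b+1) x)) (i : ℕ)
    (hbase : ∀ x : XX P Q (i+1) 0, ∃ v, D2 P Q _ 0 v = θ _ _ x)
    (w : XX P Q 0 (i+1)) (w' : XX P Q 1 i) (h : D1 P Q _ _ w' = D2 P Q _ _ w) :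
    ∃ v u, θ _ _ w = D1 P Q _ _ v + D2 P Q 0 (i+1) u := by
  obtain ⟨v, hv⟩ := chase (fun a b => XX P Q a b) (D1 P Q) (D2 P Q) (DD_comm P Q)
    (D1_sq P Q) (D2_sq P Q) θ (fun a b => AddMonoidHom.id _) θ1 θ2
    (fun _ _ _ => rfl) (fun _ _ _ => rfl) (fun _ _ _ => rfl) (fun _ _ _ => rfl) i
    (fun a b _ y hy => D1_ex P Q hP _ _ y hy)
    (fun a b _ c hc => D2_ex P Q hQ _ _ c hc)
    (fun w w' hw => by
      obtain ⟨v, hv⟩ := hbase w'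
      exact ⟨v, by rw [← DD_comm, hv, ← θ1, hw, θ2]⟩) i 0 (by omega) w w' h
  obtain ⟨u, hu⟩ := D2_ex P Q hQ _ _ (θ _ _ w - D1 P Q _ _ v) (by rw [map_sub, hv, sub_self])
  exact ⟨v, u, by rw [hu]; abel⟩

theorem L3 (hpp : ∀ e y, p e (p e y) = p e y) {k : Type} [Field k] (ε : T →+* k)
    (hεp : ∀ e, e ≠ 0 → ∀ y, ε (p e y) = 0)
    (hP : P.Ex) (hmin : ∀ i g h, ε (P.D i g h) = 0) 
    (g0 : P.J 0) (hg0 : ∀ g, g = g0) (hdg0 : P.deg 0 g0 = 0)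
    (AP : ∀ x : P.J 0 → T, ε (x g0) = 0 → ∃ y, P.δ 0 y = x)
    (AQ1 : ∀ x : Q.J 0 → T, (∀ h, ε (x h) = 0) → ∃ y, Q.δ 0 y = x)
    (hQdeg : ∀ i h, Q.deg i h = i)
    (i : ℕ) (d : ℤ) (hd : d ≠ i + 1)
    (kill : ∀ r, ε r = 0 → ∀ z, Q.δ i z = 0 → ∃ y, Q.δ (i+1) y = r • z)
    (hv : ∀ a b, a + 1 + b = i → ∀ g : P.J (a+2), HV Q b (d - P.deg _ g))
    (hv0 : ∀ g : P.J (i+2), P.deg _ g ≠ d) : HV Q i d := by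
  intro z hz
  let x : XX P Q 0 (i+1) := fun _ => Q.pr (i+1) d z
  obtain ⟨w1, hw1⟩ := D1_lift P Q 0 (i+1) x (fun h => AP _ (by
    simp only [x, GC.pr_apply]
    apply hεp
    rw [hQdeg]; push_cast; omega))
  have hx : D2 P Q _ _ x = 0 := by
    ext g h
    simp only [x, D2_apply]
    rw [← GC.pr_δ, hz]; simp
  obtain ⟨w', hw'⟩ := D1_ex P Q hP _ _ (D2 P Q _ _ w1) (by rw [DD_comm, hw1, hx])
  obtain ⟨v, hv⟩ := chase (fun a b => XX P Q (a+1) b) (fun a b => D1 P Q (a+1) b) 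
    (fun a b => D2 P Q (a+1) b) (fun a => DD_comm P Q (a+1))
    (fun a => D1_sq P Q (a+1)) (fun a => D2_sq P Q (a+1)) (fun a => PR P Q d (a+1))
    (fun a => PR P Q d (a+1)) (fun a => PR_D1 P Q d (a+1)) (fun a => PR_D2 P Q d (a+1))
    (fun a => PR_D1 P Q d (a+1)) (fun a => PR_D2 P Q d (a+1)) 
    (fun a => PR_PR P Q hpp d (a+1)) (fun a => PR_PR P Q hpp d (a+1)) i
    (fun a b _ y hy => by
      obtain ⟨v, rfl⟩ := D1_ex P Q hP _ _ y hy
      exact ⟨_, (PR_D1 P Q d _ _ v).symm⟩)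
    (fun a b hab c hc => D2_lift P Q _ _ _ fun g => hv a b hab g (c g) (by
      rw [← D2_apply, hc]; rfl))
    (fun w w' hw => by
      obtain ⟨v, hv⟩ := D2_lift P Q (i+2) 0 (PR P Q d _ _ w') (fun g => AQ1 _ fun h => by
        rw [PR_apply, GC.pr_apply]
        apply hεp
        rw [hQdeg]
        have := hv0 g
        push_cast; omega)
      exact ⟨v, by rw [← DD_comm, hv, ← PR_D1, hw, PR_D2]⟩) i 0 (by omega) w1 w' hw'
  set c := PR P Q d _ _ w1 - D1 P Q _ _ v with hcdef
  have hc : D2 P Q _ _ c = 0 := by rw [hcdef, map_sub]; exact sub_eq_zero.2 hv.symm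
  have hc1 : D1 P Q _ _ c = x := by
    rw [hcdef, map_sub, ← PR_D1, hw1, D1_sq, sub_zero]
    ext g h
    simp [x, PR_apply, GC.pr_apply, hg0 g, hdg0, hpp]
  have : Q.pr (i+1) d z = ∑ g, P.D 0 g g0 • c g := by
    ext h
    rw [show Q.pr (i+1) d z h = x g0 h from rfl, ← hc1, D1_apply, GC.δ_apply]
    simp
  rw [this]
  change _ ∈ LinearMap.range (Q.δ (i+1))
  refine Submodule.sum_mem _ fun g _ => kill _ (hmin _ _ _) _ ?_
  rw [← D2_apply, hc]; rfl

end

section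
variable {S R : Type} [CommRing S] [CommRing R] {pS : ℤ → S →+ S} {pR : ℤ → R →+ R}

/-- base change -/
abbrev GC.map (Q : GC S pS) (φ : S →+* R) (hφ : Function.Surjective φ)
    (hc : ∀ e y, φ (pS e y) = pR e (φ y)) : GC R pR where
  J := Q.J
  fin := Q.fin
  deg := Q.deg
  D i g h := φ (Q.D i g h)
  sq i g h := by
    have := congrArg φ (Q.sq i g h)
    simpa using this
  hom i g h e y := by
    obtain ⟨y, rfl⟩ := hφ y
    rw [← map_mul, ← hc, Q.hom, map_mul, hc]

variable (P Q : GC S pS) (φ : S →+* R) (hφ : Function.Surjective φ)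
    (hc : ∀ e y, φ (pS e y) = pR e (φ y))

theorem map_δ (i : ℕ) (x h) : (Q.map φ hφ hc).δ i (fun g => φ (x g)) h = φ (Q.δ i x h) := by
  simp [GC.δ_apply]

theorem L1two (hP : P.Ex) (hQ : Q.Ex) (g0 : P.J 0) (hg0 : ∀ g, g = g0)
    (AP : ∀ x : P.J 0 → S, φ (x g0) = 0 ↔ ∃ y, P.δ 0 y = x)
    (θ : ∀ a b, XX P Q a b →+ XX P Q a b)
    (θ1 : ∀ a b x, θ a b (D1 P Q a b x) = D1 P Q a b (θ (a+1) b x))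
    (θ2 : ∀ a b x, θ a b (D2 P Q a b x) = D2 P Q a b (θ a (b+1) x)) (i : ℕ)
    (hbase : ∀ x : XX P Q (i+1) 0, ∃ v, D2 P Q _ 0 v = θ _ _ x)
    (z : Q.J (i+1) → R) (hz : (Q.map φ hφ hc).δ i z = 0) :
    ∃ w : XX P Q 0 (i+1), (∀ g h, φ (w g h) = z h) ∧
      ∃ y, (Q.map φ hφ hc).δ (i+1) y = fun h => φ (θ _ _ w g0 h) := by
  obtain ⟨f, hf'⟩ := hφ.hasRightInverse
  have hf : ∀ y, φ (f y) = y := hf'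
  refine ⟨fun _ h => f (z h), fun g h => hf _, ?_⟩
  set w : XX P Q 0 (i+1) := fun _ h => f (z h) with hw
  obtain ⟨w', hw'⟩ := D1_lift P Q 0 i (D2 P Q _ _ w) (fun h => (AP _).1 (by
    rw [D2_apply, ← map_δ Q φ hφ hc]
    simp only [hw, hf]
    exact congrFun hz h))
  obtain ⟨v, u, huv⟩ := L1gen P Q hP hQ θ θ1 θ2 i hbase w w' hw'
  refine ⟨fun h => φ (u g0 h), ?_⟩
  ext h
  rw [map_δ, huv, Pi.add_apply, Pi.add_apply, map_add, D2_apply]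
  have := (AP (fun g => D1 P Q 0 (i+1) v g h)).2 ⟨_, rfl⟩
  rw [this, zero_add]

theorem L1a {k : Type} [Field k] (ε : S →+* k)
    (hεp : ∀ e, e ≠ 0 → ∀ y, ε (pS e y) = 0) 
    (AQ1 : ∀ x : Q.J 0 → S, (∀ h, ε (x h) = 0) → ∃ y, Q.δ 0 y = x)
    (hQdeg : ∀ i h, Q.deg i h = i)
    (hP : P.Ex) (hQ : Q.Ex) (g0 : P.J 0) (hg0 : ∀ g, g = g0) (hdg0 : P.deg 0 g0 = 0)
    (AP : ∀ x : P.J 0 → S, φ (x g0) = 0 ↔ ∃ y, P.δ 0 y = x) (i : ℕ) (d : ℤ)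
    (hd : ∀ g : P.J (i+1), P.deg _ g ≠ d) : HV (Q.map φ hφ hc) i d := by
  intro z hz
  obtain ⟨w, hw, y, hy⟩ := L1two P Q φ hφ hc hP hQ g0 hg0 AP (PR P Q d) (PR_D1 P Q d)
    (PR_D2 P Q d) i (fun x => D2_lift P Q _ _ _ fun g => AQ1 _ fun h => by
      rw [PR_apply, GC.pr_apply]
      apply hεp
      rw [hQdeg]
      have := hd g
      push_cast; omega) z hz
  refine ⟨y, hy.trans ?_⟩
  ext h
  rw [PR_apply, GC.pr_apply, GC.pr_apply, hc, hw, hdg0, sub_zero]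

theorem L1b {k : Type} [Field k] (ε : S →+* k)
    (AQ1 : ∀ x : Q.J 0 → S, (∀ h, ε (x h) = 0) → ∃ y, Q.δ 0 y = x)
    (hP : P.Ex) (hQ : Q.Ex) (g0 : P.J 0) (hg0 : ∀ g, g = g0)
    (AP : ∀ x : P.J 0 → S, φ (x g0) = 0 ↔ ∃ y, P.δ 0 y = x) (i : ℕ)
    (r : S) (hr : ε r = 0) (z) (hz : (Q.map φ hφ hc).δ i z = 0) :
    ∃ y, (Q.map φ hφ hc).δ (i+1) y = φ r • z := by
  obtain ⟨w, hw, y, hy⟩ := L1two P Q φ hφ hc hP hQ g0 hg0 AP (ML P Q r) (ML_D1 P Q r)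
    (ML_D2 P Q r) i (fun x => D2_lift P Q _ _ _ fun g => AQ1 _ fun h => by
      simp [ML_apply, hr]) z hz
  refine ⟨y, hy.trans ?_⟩
  ext h
  simp [ML_apply, hw]

theorem L2 (hpp : ∀ e y, pS e (pS e y) = pS e y) {k : Type} [Field k] (ε : S →+* k)
    (hp1 : pS 0 1 = 1) (hP : P.Ex) (hQ : Q.Ex) (hmin : ∀ i g h, ε (P.D i g h) = 0)
    (c : Q.J 0 → k) (AQ1 : ∀ x : Q.J 0 → S, (∀ h, ε (x h) = 0) → ∃ y, Q.δ 0 y = x)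
    (AQ2 : ∀ y, ∑ h, ε (Q.δ 0 y h) * c h = 0) (h0 : Q.J 0) (hch : c h0 ≠ 0)
    (hQdeg : ∀ i h, Q.deg i h = i)
    (g0 : P.J 0) (hg0 : ∀ g, g = g0) (hdg0 : P.deg 0 g0 = 0)
    (AP : ∀ x : P.J 0 → S, φ (x g0) = 0 ↔ ∃ y, P.δ 0 y = x) (j : ℕ) (d : ℤ)
    (hv : HV (Q.map φ hφ hc) j d) (g : P.J (j+1)) : P.deg _ g ≠ d := by
  intro hg
  refine L24 P Q hpp ε hp1 hP hmin c AQ1 AQ2 h0 hch (by simp [hQdeg]) j d g hg ?_ ?_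
  · intro b a _ y hy
    obtain ⟨v, rfl⟩ := D1_ex Q P hQ _ _ y hy
    exact ⟨_, (PR_D1 Q P d _ _ v).symm⟩
  · intro w w' hw
    obtain ⟨y, hy⟩ := hv (fun h => φ (w' h g0)) (by
      ext h
      rw [map_δ, ← D1_apply, hw, D2_apply]
      exact (AP _).2 ⟨_, rfl⟩)
    obtain ⟨f, hf'⟩ := hφ.hasRightInverse
    have hf : ∀ y, φ (f y) = y := hf'
    let s : XX Q P (j+2) 0 := fun h _ => f (y h)
    obtain ⟨v, hv⟩ := D2_lift Q P (j+1) 0 (PR Q P d _ _ w' - D1 Q P _ _ s) (fun h => (AP _).1 (by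
      rw [Pi.sub_apply, Pi.sub_apply, map_sub, D1_apply, ← map_δ Q φ hφ hc]
      simp only [s, hf]
      rw [hy, PR_apply, GC.pr_apply, GC.pr_apply, hc, hdg0, sub_zero, sub_self]))
    exact ⟨v, by rw [← DD_comm, hv, map_sub, D1_sq, sub_zero, ← PR_D1, hw, PR_D2]⟩

end

section
variable {T : Type} [CommRing T] {p : ℤ → T →+ T} (P Q : GC T p)

theorem L4 (hpp : ∀ e y, p e (p e y) = p e y) {k : Type} [Field k] (ε : T →+* k)
    (hεp : ∀ e, e ≠ 0 → ∀ y, ε (p e y) = 0)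
    (hp1 : p 0 1 = 1) (hP : P.Ex) (hmin : ∀ i g h, ε (P.D i g h) = 0)
    (c : Q.J 0 → k) (AQ1 : ∀ x : Q.J 0 → T, (∀ h, ε (x h) = 0) → ∃ y, Q.δ 0 y = x)
    (AQ2 : ∀ y, ∑ h, ε (Q.δ 0 y h) * c h = 0) (h0 : Q.J 0) (hch : c h0 ≠ 0)
    (hQdeg : ∀ i h, Q.deg i h = i)
    (g0 : P.J 0) (hdg0 : P.deg 0 g0 = 0)
    (AP : ∀ x : P.J 0 → T, ε (x g0) = 0 → ∃ y, P.δ 0 y = x) (j : ℕ) (d : ℤ) (hd : d ≠ j + 1)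
    (hv : ∀ b a, b + 1 + a = j → ∀ g : P.J a, HV Q b (d - P.deg _ g))
    (g : P.J (j+1)) : P.deg _ g ≠ d := by
  intro hg
  refine L24 P Q hpp ε hp1 hP hmin c AQ1 AQ2 h0 hch (by simp [hQdeg]) j d g hg ?_ ?_
  · intro b a hab y hy
    refine D1_lift Q P _ _ _ fun g => ?_
    obtain ⟨v, hv⟩ := hv b a hab g (fun h => y h g) (by rw [← D1_swap, hy]; rfl)
    refine ⟨v, hv.trans ?_⟩
    ext h
    rw [PR_apply']
  · intro w w' hw
    obtain ⟨v, hv⟩ := D2_lift Q P (j+1) 0 (PR Q P d _ _ w') (fun h => AP _ (by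
      rw [PR_apply, GC.pr_apply]
      apply hεp
      rw [hQdeg, hdg0]; push_cast; omega))
    exact ⟨v, by rw [← DD_comm, hv, ← PR_D1, hw, PR_D2]⟩

end

section
variable {A : Type} [CommRing A] {hom : ℕ → Set A} {M : Type} [AddCommGroup M] [Module A M]

noncomputable instance resFin (res : MinGradedFreeRes A hom M) (i : ℕ) :
    Fintype ((j : ℤ) × Fin (res.β i j)) := by
  have : Finite (Function.support (res.β i)) := res.finβ i
  have : Finite ((j : ℤ) × Fin (res.β i j)) := by
    refine Finite.of_surjective
      (fun x : (j : Function.support (res.β i)) × Fin (res.β i j) => ⟨x.1.1, x.2⟩) ?_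
    rintro ⟨j, a⟩
    exact ⟨⟨⟨j, by have := a.2; simp only [Function.mem_support]; omega⟩, a⟩, rfl⟩
  exact Fintype.ofFinite _

theorem free_sum {ι : Type} [Fintype ι] {N : Type} [AddCommGroup N] [Module A N]
    (f : (ι →₀ A) →ₗ[A] N) (x : ι →₀ A) :
    f x = ∑ g, x g • f (Finsupp.single g 1) := by
  conv_lhs => rw [← Finsupp.univ_sum_single x]
  rw [map_sum]
  refine Finset.sum_congr rfl fun g _ => ?_
  rw [← map_smul, Finsupp.smul_single, smul_eq_mul, mul_one]

noncomputable abbrev toGC (res : MinGradedFreeRes A hom M) (p : ℤ → A →+ A)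
    (hh : ∀ m, ∀ r ∈ hom m, ∀ (e : ℤ) y, p (e + m) (r * y) = r * p e y) : GC A p where
  J i := (j : ℤ) × Fin (res.β i j)
  fin i := resFin res i
  deg i g := g.1
  D i g h := res.d i (Finsupp.single g 1) h
  sq i g h := by
    have h1 : res.d i (res.d (i+1) (Finsupp.single g 1)) = 0 := by
      have : res.d (i+1) (Finsupp.single g 1) ∈ LinearMap.ker (res.d i) := by
        rw [← res.exact]; exact ⟨_, rfl⟩
      exact this
    rw [free_sum] at h1
    have := DFunLike.congr_fun h1 h
    simpa [Finsupp.finsetSum_apply] using this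
  hom i g h e y := by
    rcases res.graded i g.1 g.2 h.1 h.2 with h1 | ⟨m, hm, h1⟩
    · have h1' : res.d i (Finsupp.single g 1) h = 0 := h1
      rw [h1']; simp
    · rw [← hm]
      exact hh m _ h1 e y

variable (res : MinGradedFreeRes A hom M) (p : ℤ → A →+ A)
    (hh : ∀ m, ∀ r ∈ hom m, ∀ (e : ℤ) y, p (e + m) (r * y) = r * p e y)

theorem toGC_d (i : ℕ) (x : FreeMod A (res.β (i+1))) :
    (toGC res p hh).δ i x = res.d i x := by
  ext h
  rw [free_sum (res.d i) x, GC.δ_apply]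
  simp [Finsupp.finsetSum_apply, mul_comm]

theorem toFree (i : ℕ) (x : (toGC res p hh).J i → A) : ∃ y : FreeMod A (res.β i), x = y := by
  exact ⟨Finsupp.equivFunOnFinite.symm x, by simp⟩

theorem toGC_Ex : (toGC res p hh).Ex := by
  intro i x hx
  obtain ⟨x, rfl⟩ := toFree res p hh _ x
  rw [toGC_d] at hx
  have : x ∈ LinearMap.range (res.d (i+1)) := by
    rw [res.exact]
    exact DFunLike.coe_injective hx
  obtain ⟨y, rfl⟩ := this
  exact ⟨y, toGC_d res p hh _ _⟩

theorem toGC_aug (x : (toGC res p hh).J 0 → A) : (∃ y, (toGC res p hh).δ 0 y = x) ↔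
    ∑ h, x h • res.aug (Finsupp.single h 1) = 0 := by
  obtain ⟨x, rfl⟩ := toFree res p hh _ x
  rw [← free_sum res.aug x]
  constructor
  · rintro ⟨y, hy⟩
    obtain ⟨y, rfl⟩ := toFree res p hh _ y
    rw [toGC_d] at hy
    have : x ∈ LinearMap.ker res.aug := by
      rw [← res.exact₀]
      exact ⟨y, DFunLike.coe_injective hy⟩
    exact this
  · intro hx
    have : x ∈ LinearMap.range (res.d 0) := by
      rw [res.exact₀]; exact hx
    obtain ⟨y, rfl⟩ := this
    exact ⟨y, toGC_d res p hh _ _⟩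

end

theorem core {S R k : Type} [CommRing S] [CommRing R] [Field k] {pS : ℤ → S →+ S} {pR : ℤ → R →+ R}
    (φ : S →+* R) (hφ : Function.Surjective φ) (hc : ∀ e y, φ (pS e y) = pR e (φ y))
    (εS : S →+* k) (εR : R →+* k) (hε : ∀ x, εR (φ x) = εS x)
    (hpp : ∀ e y, pS e (pS e y) = pS e y) (hp1 : pS 0 1 = 1)
    (hεp : ∀ e, e ≠ 0 → ∀ y, εS (pS e y) = 0)
    (F K : GC S pS) (G : GC R pR) (hF : F.Ex) (hK : K.Ex) (hG : G.Ex)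
    (hminF : ∀ i g h, εS (F.D i g h) = 0) (hminG : ∀ i g h, εR (G.D i g h) = 0)
    (hKdeg : ∀ i h, K.deg i h = i)
    (c : K.J 0 → k) (AK : ∀ x : K.J 0 → S, (∃ y, K.δ 0 y = x) ↔ ∑ h, εS (x h) * c h = 0)
    (h0 : K.J 0) (hch : c h0 ≠ 0)
    (f0 : F.J 0) (hf0 : ∀ g, g = f0) (hdf0 : F.deg 0 f0 = 0)
    (AF : ∀ x : F.J 0 → S, φ (x f0) = 0 ↔ ∃ y, F.δ 0 y = x)
    (g0 : G.J 0) (hg0 : ∀ g, g = g0) (hdg0 : G.deg 0 g0 = 0)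
    (AG : ∀ x : G.J 0 → R, εR (x g0) = 0 → ∃ y, G.δ 0 y = x)
    (n q : ℕ) (hq : 1 ≤ q)
    (hreg : ∀ i ≤ n + 1, ∀ g, G.deg i g ≤ i + 1)
    (hN : ∀ i, 1 ≤ i → i ≤ q → ∀ g, F.deg i g ≤ i + 1) :
    ∀ i : ℕ, q + 1 ≤ i → i ≤ n → ∀ g, F.deg i g ≤ 2 * (i : ℤ) - q + 1 := by
  have hppR : ∀ e y, pR e (pR e y) = pR e y := by
    intro e y
    obtain ⟨y, rfl⟩ := hφ y
    rw [← hc, ← hc, hpp]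
  have hp1R : pR 0 1 = 1 := by rw [← map_one φ, ← hc, hp1]
  have hεpR : ∀ e, e ≠ 0 → ∀ y, εR (pR e y) = 0 := by
    intro e he y
    obtain ⟨y, rfl⟩ := hφ y
    rw [← hc, hε, hεp e he]
  have AK1 : ∀ x : K.J 0 → S, (∀ h, εS (x h) = 0) → ∃ y, K.δ 0 y = x := fun x hx =>
    (AK x).2 (by simp [hx])
  have AK2 : ∀ y, ∑ h, εS (K.δ 0 y h) * c h = 0 := fun y => (AK _).1 ⟨y, rfl⟩
  set KR : GC R pR := K.map φ hφ hc with hKR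
  have AR1 : ∀ x : KR.J 0 → R, (∀ h, εR (x h) = 0) → ∃ y, KR.δ 0 y = x := by
    intro x hx
    choose f hf using fun h => hφ (x h)
    obtain ⟨y, hy⟩ := AK1 f (fun h => by rw [← hε, hf, hx])
    refine ⟨fun g => φ (y g), ?_⟩
    ext h
    refine (map_δ K φ hφ hc 0 y h).trans ?_
    rw [hy, hf]
  have AR2 : ∀ y, ∑ h, εR (KR.δ 0 y h) * c h = 0 := by
    intro y
    choose f hf using fun h => hφ (y h)
    rw [← AK2 f]
    refine Finset.sum_congr rfl fun h _ => ?_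
    rw [← hε, ← map_δ K φ hφ hc]
    simp only [hf]
    rfl
  have hKRdeg : ∀ i h, KR.deg i h = i := hKdeg
  have l1a := L1a F K φ hφ hc εS hεp AK1 hKdeg hF hK f0 hf0 hdf0 AF
  have kill : ∀ i r, εR r = 0 → ∀ z, KR.δ i z = 0 → ∃ y, KR.δ (i+1) y = r • z := by
    intro i r hr z hz
    obtain ⟨r, rfl⟩ := hφ r
    exact L1b F K φ hφ hc εS AK1 hF hK f0 hf0 AF i r (by rw [← hε, hr]) z hz
  have B : ∀ j, j ≤ q + 1 → ∀ g, G.deg j g ≤ j := by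
    intro j
    induction j using Nat.strong_induction_on with
    | _ j ih =>
      intro hj g
      rcases j with _ | j
      · rw [hg0 g, hdg0]; simp
      · by_contra hlt
        refine L4 G KR hppR εR hεpR hp1R hG hminG c AR1 AR2 h0 hch hKRdeg g0 hdg0 AG j
          (G.deg _ g) (by push_cast at hlt; omega) ?_ g rfl
        intro b a hab g'
        apply l1a
        intro f
        have h1 := hN (b+1) (by omega) (by omega) f
        have h2 := ih a (by omega) (by omega) g'
        push_cast at *
        omega
  intro i
  induction i using Nat.strong_induction_on with
  | _ i ih =>
    intro hi hin f
    rcases i with _ | i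
    · omega
    · by_contra hlt
      refine L2 F K φ hφ hc hpp εS hp1 hF hK hminF c AK1 AK2 h0 hch hKdeg f0 hf0 hdf0 AF i
        (F.deg _ f) ?_ f rfl
      refine L3 G KR hppR εR hεpR hG hminG g0 hg0 hdg0 AG AR1 hKRdeg i _ ?_ (kill i) ?_ ?_
      · push_cast at hlt; omega
      · intro a b hab g
        apply l1a
        intro f'
        have h1 : F.deg (b+1) f' ≤ b + 2 ∨ F.deg (b+1) f' ≤ 2 * (b + 1) - q + 1 := by
          rcases Nat.lt_or_ge q (b+1) with h | h
          · right
            have := ih (b+1) (by omega) (by omega) (by omega) f'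
            push_cast at this; omega
          · left
            have := hN (b+1) (by omega) (by omega) f'
            push_cast at this; omega
        have h2 := hreg (a+2) (by omega) g
        rcases Nat.lt_or_ge (q+1) (a+2) with h | h
        · push_cast at *
          omega
        · have h3 := B (a+2) h g
          push_cast at *
          omega
      · intro g
        have h2 := hreg (i+2) (by omega) g
        push_cast at *
        omega

section
variable {k S : Type} [Field k] [CommRing S] [Algebra k S]
    (𝒜 : ℕ → Submodule k S) [GradedAlgebra 𝒜]

noncomputable def pS (e : ℤ) : S →+ S := if 0 ≤ e then GradedRing.proj 𝒜 e.toNat else 0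

theorem pS_mul (m : ℕ) (r : S) (hr : r ∈ 𝒜 m) (e : ℤ) (y : S) :
    pS 𝒜 (e + m) (r * y) = r * pS 𝒜 e y := by
  unfold pS
  by_cases he : 0 ≤ e
  · rw [if_pos he, if_pos (by omega), GradedRing.proj_apply, GradedRing.proj_apply,
      show (e + m).toNat = m + e.toNat by omega]
    exact DirectSum.coe_decompose_mul_add_of_left_mem 𝒜 hr
  · rw [if_neg he]
    by_cases he' : 0 ≤ e + m
    · rw [if_pos he', GradedRing.proj_apply, 
        DirectSum.coe_decompose_mul_of_left_mem_of_not_le 𝒜 hr (by omega)]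
      simp
    · rw [if_neg he']; simp

theorem pS_mem (e : ℤ) (y : S) : pS 𝒜 e y = 0 ∨ 0 ≤ e ∧ pS 𝒜 e y ∈ 𝒜 e.toNat := by
  unfold pS
  by_cases he : 0 ≤ e
  · rw [if_pos he]
    right
    exact ⟨he, by rw [GradedRing.proj_apply]; exact SetLike.coe_mem _⟩
  · left; rw [if_neg he]; rfl

theorem pS_idem (e : ℤ) (y : S) : pS 𝒜 e (pS 𝒜 e y) = pS 𝒜 e y := by
  rcases pS_mem 𝒜 e y with h | ⟨h0, h⟩
  · rw [h, map_zero]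
  · generalize pS 𝒜 e y = z at *
    unfold pS
    rw [if_pos h0, GradedRing.proj_apply, DirectSum.decompose_of_mem_same 𝒜 h]

theorem pS_one : pS 𝒜 0 1 = 1 := by
  unfold pS
  rw [if_pos le_rfl, GradedRing.proj_apply]
  exact DirectSum.decompose_of_mem_same 𝒜 (SetLike.GradedOne.one_mem (A := 𝒜))

theorem pS_ideal (I : Ideal S) (hI : Ideal.IsHomogeneous 𝒜 I) (e : ℤ) (y : S) (hy : y ∈ I) :
    pS 𝒜 e y ∈ I := by
  unfold pS
  by_cases he : 0 ≤ e
  · rw [if_pos he, GradedRing.proj_apply]; exact hI _ hy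
  · rw [if_neg he]; simp

theorem exists_pR (I : Ideal S) (hI : Ideal.IsHomogeneous 𝒜 I) :
    ∃ pR : ℤ → (S ⧸ I) →+ (S ⧸ I), ∀ e y, Ideal.Quotient.mk I (pS 𝒜 e y) =
      pR e (Ideal.Quotient.mk I y) := by
  have hs := Ideal.Quotient.mk_surjective (I := I)
  obtain ⟨f, hf'⟩ := hs.hasRightInverse
  have hf : ∀ y, Ideal.Quotient.mk I (f y) = y := hf'
  have key : ∀ e y, Ideal.Quotient.mk I (pS 𝒜 e y) =
      Ideal.Quotient.mk I (pS 𝒜 e (f (Ideal.Quotient.mk I y))) := by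
    intro e y
    rw [Ideal.Quotient.eq, ← map_sub]
    apply pS_ideal 𝒜 I hI
    rw [← Ideal.Quotient.eq, hf]
  refine ⟨fun e => AddMonoidHom.mk' (fun y => Ideal.Quotient.mk I (pS 𝒜 e (f y))) ?_, key⟩
  intro a b
  obtain ⟨a, rfl⟩ := hs a
  obtain ⟨b, rfl⟩ := hs b
  rw [← map_add, ← key, ← key, ← key, map_add, map_add]

end

theorem uniq_gen (b : ℤ → ℕ) (hb : ∀ j, b j = if j = 0 then 1 else 0) :
    ∃ g0 : (j : ℤ) × Fin (b j), g0.1 = 0 ∧ ∀ g, g = g0 := by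
  obtain rfl : b = fun j => if j = 0 then 1 else 0 := funext hb
  refine ⟨⟨0, ⟨0, by simp⟩⟩, rfl, ?_⟩
  rintro ⟨j, a⟩
  by_cases hj : j = 0
  · subst hj
    congr 1
    apply Fin.ext
    have := a.2
    simp at this ⊢
  · have := a.2
    simp [hj] at this
end TLe
/-- Let `S` be a standard graded Koszul algebra over `k` and `R = S/I` with
`reg_{n+1}^R(k) ≤ 1` for some `n ≥ 1` and satisfying the Green–Lazarsfeld condition `N_q`
over `S` for some `q ≥ 1` (i.e. `t_i^S(R) = i + 1` for `1 ≤ i ≤ q`).  Then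
`t_i^S(R) ≤ 2i − q + 1` for `q + 1 ≤ i ≤ n`. -/
theorem t_le_of_Nq
    (k : Type) [Field k] (S : Type) [CommRing S] [Algebra k S]
    (𝒜 : ℕ → Submodule k S) [GradedAlgebra 𝒜]
    (hstd : ∀ m, 𝒜 (m + 1) = 𝒜 m * 𝒜 1)
    (ε : S →ₐ[k] k) (hε : ∀ m, 1 ≤ m → ∀ x ∈ 𝒜 m, ε x = 0)
    (I : Ideal S) (hI : Ideal.IsHomogeneous 𝒜 I)
    (hIε : ∀ a ∈ I, ε a = 0)
    (n q : ℕ) (hn : 1 ≤ n) (hq : 1 ≤ q) :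
    letI : Module S k := Module.compHom k ε.toRingHom
    letI : Module (S ⧸ I) k :=
      Module.compHom k (Ideal.Quotient.lift I ε.toRingHom hIε)
    ∀ (Kres : MinGradedFreeRes S (fun m => (𝒜 m : Set S)) k),
      (∀ (i : ℕ) (j : ℤ), Kres.β i j ≠ 0 → j = (i : ℤ)) →
    ∀ (Rres : MinGradedFreeRes S (fun m => (𝒜 m : Set S)) (S ⧸ I)),
      (∀ j : ℤ, Rres.β 0 j = if j = 0 then 1 else 0) →
    ∀ (kres : MinGradedFreeRes (S ⧸ I)
        (fun m => (Ideal.Quotient.mk I) '' (𝒜 m : Set S)) k),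
      (∀ j : ℤ, kres.β 0 j = if j = 0 then 1 else 0) →
      (∀ i ≤ n + 1, ∀ j : ℤ, kres.β i j ≠ 0 → j ≤ (i : ℤ) + 1) →
      (∀ i : ℕ, 1 ≤ i → i ≤ q →
        (∀ j : ℤ, Rres.β i j ≠ 0 → j ≤ (i : ℤ) + 1) ∧ Rres.β i ((i : ℤ) + 1) ≠ 0) →
    ∀ i : ℕ, q + 1 ≤ i → i ≤ n → ∀ j : ℤ, Rres.β i j ≠ 0 →
      j ≤ 2 * (i : ℤ) - q + 1 := by
  letI mS : Module S k := Module.compHom k ε.toRingHom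
  letI mR : Module (S ⧸ I) k := Module.compHom k (Ideal.Quotient.lift I ε.toRingHom hIε)
  intro Kres hKlin Rres hR0 kres hk0 hreg hN
  obtain ⟨pR, hpR⟩ := TLe.exists_pR 𝒜 I hI
  have hhS : ∀ m, ∀ r ∈ (𝒜 m : Set S), ∀ (e : ℤ) y,
      TLe.pS 𝒜 (e + m) (r * y) = r * TLe.pS 𝒜 e y := fun m r hr => TLe.pS_mul 𝒜 m r hr
  have hs := Ideal.Quotient.mk_surjective (I := I)
  have hhR : ∀ m, ∀ r ∈ (Ideal.Quotient.mk I) '' (𝒜 m : Set S), ∀ (e : ℤ) y,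
      pR (e + m) (r * y) = r * pR e y := by
    rintro m _ ⟨r, hr, rfl⟩ e y
    obtain ⟨y, rfl⟩ := hs y
    rw [← map_mul, ← hpR, hhS m r hr, map_mul, hpR]
  obtain ⟨f0, hf1, hf0⟩ := TLe.uniq_gen _ hR0
  obtain ⟨g0, hg1, hg0⟩ := TLe.uniq_gen _ hk0
  have hch : ∃ h0, Kres.aug (Finsupp.single h0 1) ≠ 0 := by
    by_contra hcon
    push Not at hcon
    obtain ⟨y, hy⟩ := Kres.augSurj 1
    rw [TLe.free_sum] at hy
    simp [hcon] at hy
  obtain ⟨h0, hch⟩ := hch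
  intro i hi hin j hj
  refine TLe.core (k := k) (Ideal.Quotient.mk I) hs hpR ε.toRingHom
    (Ideal.Quotient.lift I ε.toRingHom hIε) (fun x => rfl) (TLe.pS_idem 𝒜) (TLe.pS_one 𝒜) ?_
    (TLe.toGC Rres _ hhS) (TLe.toGC Kres _ hhS) (TLe.toGC kres _ hhR)
    (TLe.toGC_Ex _ _ _) (TLe.toGC_Ex _ _ _) (TLe.toGC_Ex _ _ _) ?_ ?_ ?_
    (fun h => Kres.aug (Finsupp.single h 1)) ?_ h0 hch f0 hf0 hf1 ?_ g0 hg0 hg1 ?_ n q hq ?_ ?_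
    i hi hin ⟨j, ⟨0, Nat.pos_of_ne_zero hj⟩⟩
  · intro e he y
    rcases TLe.pS_mem 𝒜 e y with h | ⟨h1, h⟩
    · rw [h, map_zero]
    · exact hε e.toNat (by omega) _ h
  · intro i g h
    change ε (Rres.d i (Finsupp.single g 1) h) = 0
    by_cases h1 : Rres.d i (Finsupp.single g 1) h = 0
    · rw [h1, map_zero]
    · have h2 := Rres.minimal i g.1 g.2 h.1 h.2 h1
      rcases Rres.graded i g.1 g.2 h.1 h.2 with h3 | ⟨m, hm, h3⟩
      · exact absurd h3 h1
      · exact hε m (by omega) _ h3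
  · intro i g h
    change Ideal.Quotient.lift I ε.toRingHom hIε (kres.d i (Finsupp.single g 1) h) = 0
    by_cases h1 : kres.d i (Finsupp.single g 1) h = 0
    · rw [h1, map_zero]
    · have h2 := kres.minimal i g.1 g.2 h.1 h.2 h1
      rcases kres.graded i g.1 g.2 h.1 h.2 with h3 | ⟨m, hm, s, hs, h3⟩
      · exact absurd h3 h1
      · have h4 : Ideal.Quotient.mk I s = kres.d i (Finsupp.single g 1) h := h3
        rw [← h4]
        exact hε m (by omega) _ hs
  · intro i h
    exact hKlin i h.1 (by have := h.2.2; omega)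
  · intro x
    exact TLe.toGC_aug Kres _ hhS x
  · intro x
    rw [TLe.toGC_aug Rres _ hhS x, Fintype.sum_eq_single f0 (fun g hg => absurd (hf0 g) hg)]
    obtain ⟨y, hy⟩ := Rres.augSurj 1
    rw [TLe.free_sum, Fintype.sum_eq_single f0 (fun g hg => absurd (hf0 g) hg)] at hy
    have e1 : ∀ (s : S) (r : S ⧸ I), s • r = Ideal.Quotient.mk I s * r := fun s r =>
      Algebra.smul_def s r
    rw [e1] at hy ⊢
    constructor
    · intro h; rw [h, zero_mul]
    · intro h
      have := congrArg (Ideal.Quotient.mk I (y f0) * ·) h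
      simp only [mul_zero] at this
      rw [mul_left_comm, hy, mul_one] at this
      exact this
  · intro x hx
    rw [TLe.toGC_aug kres _ hhR x, Fintype.sum_eq_single g0 (fun g hg => absurd (hg0 g) hg)]
    change Ideal.Quotient.lift I ε.toRingHom hIε (x g0) * _ = 0
    rw [hx, zero_mul]
  · intro i hi g
    exact hreg i hi g.1 (by have := g.2.2; omega)
  · intro i h1 hi g
    exact (hN i h1 hi).1 g.1 (by have := g.2.2; omega)
end

section
/- Let S = k[x_1,…,x_n] and I ⊂ S a homogeneous ideal generated in degree d with p = pd_S(S/I). Then the minimal number of generators of I satisfies μ(I) = dim_k I_d ≤ C(d + p − 1, p − 1), the binomial coefficient. -/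
section Helpers

open CategoryTheory Abelian

lemma ext_step_gen {R : Type} [CommRing R] (κ A B : ModuleCat.{0} R) (f : A ⟶ A) (g : A ⟶ B)
    (w : f ≫ g = 0) (hS : (ShortComplex.mk f g w).ShortExact) (l : R) (hf : f = l • 𝟙 A)
    (hl : l • 𝟙 κ = 0) (r : ℕ)
    (H : ∀ i < r, ∀ e : Ext κ B i, e = 0) :
    ∀ i < r + 1, ∀ e : Ext κ A i, e = 0 := by
  intro i hi e
  have h0 : e.comp (Ext.mk₀ f) (add_zero i) = 0 := by
    rw [hf, Ext.mk₀_smul, Ext.comp_smul, Ext.comp_mk₀_id, ← e.mk₀_id_comp, ← Ext.smul_comp,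
      ← Ext.mk₀_smul, hl]
    simp
  rcases i with _ | i
  · have := Ext.postcomp_mk₀_injective_of_mono κ f (hf := hS.mono_f)
    apply this
    simpa using h0
  · obtain ⟨x, hx⟩ := Ext.covariant_sequence_exact₁ κ hS e h0 rfl
    rw [← hx, H i (by omega) x]
    simp

lemma sesQ_comp {R : Type} [CommRing R] (Q : Ideal R) (l : R) :
    (Submodule.factor (show Q ≤ Q ⊔ Ideal.span {l} from le_sup_left)) ∘ₗ
      (LinearMap.lsmul R (R ⧸ Q) l) = 0 := by
  refine LinearMap.ext fun x => ?_
  obtain ⟨x, rfl⟩ := Submodule.Quotient.mk_surjective _ x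
  show (Submodule.Quotient.mk (l * x) : R ⧸ (Q ⊔ Ideal.span {l})) = 0
  rw [Submodule.Quotient.mk_eq_zero]
  exact Submodule.mem_sup_right (Ideal.mul_mem_right _ _ (Ideal.mem_span_singleton_self l))

lemma sesQ_exact {R : Type} [CommRing R] (Q : Ideal R) (l : R)
    (h : ∀ g, l * g ∈ Q → g ∈ Q) :
    (ModuleCat.shortComplexOfCompEqZero _ _ (sesQ_comp Q l)).ShortExact := by
  refine ModuleCat.shortComplex_shortExact _ ?_ ?_ ?_
  · intro x
    obtain ⟨x, rfl⟩ := Submodule.Quotient.mk_surjective _ x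
    show (Submodule.Quotient.mk x : R ⧸ (Q ⊔ Ideal.span {l})) = 0 ↔ ∃ y : R ⧸ Q, l • y = _
    rw [Submodule.Quotient.mk_eq_zero]
    constructor
    · intro hx
      obtain ⟨a, ha, b, hb, rfl⟩ := Submodule.mem_sup.1 hx
      obtain ⟨c, rfl⟩ := Ideal.mem_span_singleton'.1 hb
      refine ⟨Submodule.Quotient.mk c, ?_⟩
      rw [← Submodule.Quotient.mk_smul]
      refine (Submodule.Quotient.eq _).2 ?_
      have : l • c - (a + c * l) = -a := by simp; ring
      rw [this]; exact neg_mem ha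
    · rintro ⟨y, hy⟩
      obtain ⟨y, rfl⟩ := Submodule.Quotient.mk_surjective _ y
      rw [← Submodule.Quotient.mk_smul] at hy
      have := (Submodule.Quotient.eq _).1 hy
      have h2 : x = -(l • y - x) + y * l := by simp; ring
      rw [h2]
      exact add_mem (Submodule.mem_sup_left (neg_mem this))
        (Submodule.mem_sup_right (Ideal.mem_span_singleton'.2 ⟨y, rfl⟩))
  · show Function.Injective (LinearMap.lsmul R (R ⧸ Q) l)
    rw [injective_iff_map_eq_zero]
    intro x hx
    obtain ⟨x, rfl⟩ := Submodule.Quotient.mk_surjective _ x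
    change l • Submodule.Quotient.mk x = (0 : R ⧸ Q) at hx
    rw [← Submodule.Quotient.mk_smul, Submodule.Quotient.mk_eq_zero] at hx
    rw [Submodule.Quotient.mk_eq_zero]
    exact h x hx
  · intro y
    obtain ⟨y, rfl⟩ := Submodule.Quotient.mk_surjective _ y
    exact ⟨Submodule.Quotient.mk y, rfl⟩

lemma pd_step {R : Type} [CommRing R] (Q : Ideal R) (l : R)
    (h : ∀ g, l * g ∈ Q → g ∈ Q) (n : ℕ)
    (hp : HasProjectiveDimensionLT (ModuleCat.of R (R ⧸ Q)) n) :
    HasProjectiveDimensionLT (ModuleCat.of R (R ⧸ (Q ⊔ Ideal.span {l}))) (n+1) :=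
  (sesQ_exact Q l h).hasProjectiveDimensionLT_X₃ n hp
    (hasProjectiveDimensionLT_of_ge (ModuleCat.of R (R ⧸ Q)) n (n+1) (by omega))

lemma ext_step {R : Type} [CommRing R] (κ : ModuleCat.{0} R) (Q : Ideal R) (l : R)
    (h : ∀ g, l * g ∈ Q → g ∈ Q) (hl : l • 𝟙 κ = 0) (r : ℕ)
    (H : ∀ i < r, ∀ e : Ext κ (ModuleCat.of R (R ⧸ (Q ⊔ Ideal.span {l}))) i, e = 0) :
    ∀ i < r + 1, ∀ e : Ext κ (ModuleCat.of R (R ⧸ Q)) i, e = 0 :=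
  ext_step_gen κ _ _ _ _ _ (sesQ_exact Q l h) l rfl hl r H

lemma ext_retract {R : Type} [CommRing R] (κ A B : ModuleCat.{0} R) (m : ℕ)
    (f : Fin m → (B ⟶ A)) (g : Fin m → (A ⟶ B)) (h : ∑ i, f i ≫ g i = 𝟙 B) (r : ℕ)
    (H : ∀ e : Ext κ A r, e = 0) (e : Ext κ B r) : e = 0 := by
  have key : ∀ φ ψ, ∀ i, (e.comp (Ext.mk₀ (f i ≫ g i)) (add_zero r)) = φ → ψ = φ → φ = 0 := by
    intro φ ψ i h1 _
    rw [← h1, ← Ext.mk₀_comp_mk₀, ← Ext.comp_assoc_of_second_deg_zero]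
    rw [H (e.comp (Ext.mk₀ (f i)) (add_zero r))]
    simp
  rw [← e.comp_mk₀_id, ← h]
  have : ∀ s : Finset (Fin m), e.comp (Ext.mk₀ (∑ i ∈ s, f i ≫ g i)) (add_zero r) = 0 := by
    intro s
    induction s using Finset.induction_on with
    | empty => simp
    | insert a s ha ih =>
      rw [Finset.sum_insert ha, Ext.mk₀_add, Ext.comp_add, ih, add_zero]
      exact key _ _ a rfl rfl
  exact this _

lemma ext_proj {R : Type} [CommRing R] (κ : ModuleCat.{0} R) (M : Type) [AddCommGroup M]
    [Module R M] [Module.Finite R M] [Module.Projective R M] (r : ℕ)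
    (H : ∀ e : Ext κ (ModuleCat.of R R) r, e = 0) (e : Ext κ (ModuleCat.of R M) r) : e = 0 := by
  obtain ⟨n, f, g, hf, hg, hfg⟩ := Module.Finite.exists_comp_eq_id_of_projective R M
  refine ext_retract κ (ModuleCat.of R R) (ModuleCat.of R M) n
    (fun i => ModuleCat.ofHom (LinearMap.proj i ∘ₗ g))
    (fun i => ModuleCat.ofHom (f ∘ₗ LinearMap.single R (fun _ => R) i)) ?_ r H e
  refine ModuleCat.hom_ext ?_
  rw [ModuleCat.hom_sum]
  refine LinearMap.ext fun x => ?_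
  have : f (g x) = x := LinearMap.congr_fun hfg x
  conv_rhs => rw [ModuleCat.hom_id, LinearMap.id_apply, ← this]
  simp only [LinearMap.sum_apply, ModuleCat.hom_comp, ModuleCat.hom_ofHom, LinearMap.comp_apply,
    ← map_sum]
  congr 1
  exact LinearMap.sum_single_apply (fun _ => R) (g x)

lemma ext_pd {R : Type} [CommRing R] [IsNoetherianRing R] (κ : ModuleCat.{0} R) (n : ℕ)
    (H : ∀ i < n, ∀ e : Ext κ (ModuleCat.of R R) i, e = 0) (p : ℕ) :
    ∀ (M : Type) [AddCommGroup M] [Module R M] [Module.Finite R M]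
    (_ : HasProjectiveDimensionLT (ModuleCat.of R M) (p + 1)) (i : ℕ) (_ : i + p < n)
    (e : Ext κ (ModuleCat.of R M) i), e = 0 := by
  induction p with
  | zero =>
    intro M _ _ _ hM i hi e
    have h1 : Projective (ModuleCat.of R M) := projective_iff_hasProjectiveDimensionLT_one.2 hM
    have : Module.Projective R M := (IsProjective.iff_projective (R := R) M).2 h1
    exact ext_proj κ M i (H i hi) e
  | succ p ih =>
    intro M _ _ _ hM i hi e
    obtain ⟨P, _, _, _, _, f, surjf⟩ := Module.exists_finite_presentation R M
    have hS := LinearMap.shortExact_shortComplexKer surjf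
    have hpr : Projective (ModuleCat.of R P) :=
      (IsProjective.iff_projective (R := R) P).1 inferInstance
    have hk := (hS.hasProjectiveDimensionLT_X₃_iff p hpr).1 hM
    obtain ⟨x, hx⟩ := Ext.covariant_sequence_exact₃ κ hS e (rfl : i + 1 = i + 1)
      (ih (LinearMap.ker f) hk (i+1) (by omega) _)
    rw [← hx, ext_proj κ P i (H i (by omega)) x]
    exact Ext.zero_comp ..


/-- length of a resolution bounds pd -/
lemma pd_of_res {R : Type} [CommRing R] (p : ℕ) : ∀ (M : Type) [AddCommGroup M] [Module R M]
    (P : ℕ → Type) [∀ i, AddCommGroup (P i)] [∀ i, Module R (P i)]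
    [∀ i, Module.Projective R (P i)]
    (d : ∀ i, P (i + 1) →ₗ[R] P i) (aug : P 0 →ₗ[R] M) (_ : Function.Surjective aug)
    (_ : Function.Exact (d 0) aug) (_ : ∀ i, Function.Exact (d (i + 1)) (d i))
    (_ : ∀ i, p < i → Subsingleton (P i)),
    HasProjectiveDimensionLT (ModuleCat.of R M) (p + 1) := by
  induction p with
  | zero =>
    intro M _ _ P _ _ _ d aug hs h0 h1 hz
    have := hz 1 (by omega)
    have inj : Function.Injective aug := by
      rw [injective_iff_map_eq_zero]
      intro x hx
      obtain ⟨y, rfl⟩ := (h0 x).1 hx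
      rw [Subsingleton.elim y 0, map_zero]
    have : Module.Projective R M := Module.Projective.of_equiv (LinearEquiv.ofBijective aug ⟨inj, hs⟩)
    have := (IsProjective.iff_projective (R := R) M).1 this
    exact projective_iff_hasProjectiveDimensionLT_one.1 this
  | succ p ih =>
    intro M _ _ P _ _ _ d aug hs h0 h1 hz
    have hS := LinearMap.shortExact_shortComplexKer hs
    have hpr : Projective (ModuleCat.of R (P 0)) :=
      (IsProjective.iff_projective (R := R) (P 0)).1 inferInstance
    refine (hS.hasProjectiveDimensionLT_X₃_iff p hpr).2 ?_
    refine ih (LinearMap.ker aug) (fun i => P (i + 1)) (fun i => d (i + 1))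
      ((d 0).codRestrict _ fun x => (h0 _).2 ⟨x, rfl⟩) ?_ ?_ (fun i => h1 (i + 1))
      (fun i hi => hz (i+1) (by omega))
    · rintro ⟨x, hx⟩
      obtain ⟨y, hy⟩ := (h0 x).1 hx
      exact ⟨y, Subtype.ext hy⟩
    · intro x
      rw [← h1 0 x]
      exact Subtype.ext_iff

open MvPolynomial

lemma span_X_reg {K : Type} [Field K] {n : ℕ} (s : Set (Fin n)) (a : Fin n) (ha : a ∉ s)
    (g : MvPolynomial (Fin n) K)
    (hg : X a * g ∈ Ideal.span ((X : Fin n → MvPolynomial (Fin n) K) '' s)) :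
    g ∈ Ideal.span ((X : Fin n → MvPolynomial (Fin n) K) '' s) := by
  rw [mem_ideal_span_X_image] at hg ⊢
  intro m hm
  have : m + Finsupp.single a 1 ∈ (X a * g).support := by
    rw [mul_comm, mem_support_iff, coeff_mul_X]
    exact mem_support_iff.1 hm
  obtain ⟨i, hi, h⟩ := hg _ this
  refine ⟨i, hi, ?_⟩
  have hne : a ≠ i := fun h => ha (h ▸ hi)
  simpa [Finsupp.single_apply, hne] using h

lemma ext_S_aux {K : Type} [Field K] {n : ℕ} (κ : ModuleCat.{0} (MvPolynomial (Fin n) K))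
    (hκ : ∀ a : Fin n, (X a : MvPolynomial (Fin n) K) • 𝟙 κ = 0) (r : ℕ) :
    ∀ j : ℕ, j + r = n → ∀ i < r, ∀ e : Ext κ (ModuleCat.of (MvPolynomial (Fin n) K)
      (MvPolynomial (Fin n) K ⧸ Ideal.span
        ((X : Fin n → MvPolynomial (Fin n) K) '' {i | i.1 < j}))) i, e = 0 := by
  induction r with
  | zero => intro j _ i hi; omega
  | succ r ih =>
    intro j hj
    refine ext_step κ _ (X ⟨j, by omega⟩) (fun g hg => span_X_reg _ _ (by simp) g hg) (hκ _) r ?_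
    have : Ideal.span ((X : Fin n → MvPolynomial (Fin n) K) '' {i | i.1 < j}) ⊔
        Ideal.span {X ⟨j, by omega⟩} =
        Ideal.span ((X : Fin n → MvPolynomial (Fin n) K) '' {i | i.1 < j + 1}) := by
      rw [← Ideal.span_union, ← Set.image_singleton, ← Set.image_union]
      congr 2
      ext i
      simp [Fin.ext_iff]
      omega
    rw [this]
    exact ih (j + 1) (by omega)

lemma ext_S {K : Type} [Field K] {n : ℕ} (κ : ModuleCat.{0} (MvPolynomial (Fin n) K))
    (hκ : ∀ a : Fin n, (X a : MvPolynomial (Fin n) K) • 𝟙 κ = 0) (i : ℕ) (hi : i < n)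
    (e : Ext κ (ModuleCat.of (MvPolynomial (Fin n) K) (MvPolynomial (Fin n) K)) i) : e = 0 := by
  have h := ext_S_aux κ hκ n 0 (by omega) i hi
  have hQ : Ideal.span ((X : Fin n → MvPolynomial (Fin n) K) '' {i | i.1 < 0}) = ⊥ := by simp
  rw [hQ] at h
  let E := (Submodule.quotEquivOfEqBot (⊥ : Ideal (MvPolynomial (Fin n) K)) rfl).toModuleIso
  refine ext_retract κ _ _ 1 (fun _ => E.inv) (fun _ => E.hom) ?_ i h e
  rw [Fin.sum_univ_one]
  exact E.inv_hom_id

lemma no_socle {K : Type} [Field K] {n : ℕ} (M : Type) [AddCommGroup M]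
    [Module (MvPolynomial (Fin n) K) M] [Module.Finite (MvPolynomial (Fin n) K) M] (p : ℕ)
    (hp : p < n) (hM : HasProjectiveDimensionLT (ModuleCat.of (MvPolynomial (Fin n) K) M) (p + 1))
    (u : M) (hu : ∀ a, (X a : MvPolynomial (Fin n) K) • u = 0) : u = 0 := by
  let m : Ideal (MvPolynomial (Fin n) K) := idealOfVars (Fin n) K
  let κ : ModuleCat.{0} (MvPolynomial (Fin n) K) := ModuleCat.of _ (MvPolynomial (Fin n) K ⧸ m)
  have hκ : ∀ a : Fin n, (X a : MvPolynomial (Fin n) K) • 𝟙 κ = 0 := by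
    intro a
    refine ModuleCat.hom_ext (LinearMap.ext fun x => ?_)
    obtain ⟨x, rfl⟩ := Submodule.Quotient.mk_surjective _ x
    show (Submodule.Quotient.mk (X a * x) : MvPolynomial (Fin n) K ⧸ m) = 0
    rw [Submodule.Quotient.mk_eq_zero]
    exact Ideal.mul_mem_right _ _ (Ideal.subset_span ⟨a, rfl⟩)
  let φ : MvPolynomial (Fin n) K ⧸ m →ₗ[MvPolynomial (Fin n) K] M :=
    Submodule.liftQ m (LinearMap.toSpanSingleton _ M u) (by
      show Ideal.span _ ≤ _
      rw [Ideal.span_le]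
      rintro _ ⟨a, rfl⟩
      simpa using hu a)
  have h := ext_pd κ n (fun i hi e => ext_S κ hκ i hi e) p M hM 0 (by omega)
    (Ext.mk₀ (ModuleCat.ofHom φ))
  have h2 : (ModuleCat.ofHom φ : κ ⟶ ModuleCat.of _ M) = 0 := by
    apply (Ext.mk₀_bijective _ _).1
    rw [h, Ext.mk₀_zero]
  have h3 : φ = 0 := by
    have := congrArg ModuleCat.Hom.hom h2
    exact this
  have h4 : φ (Submodule.Quotient.mk 1) = u := by
    show Submodule.liftQ m _ _ (Submodule.Quotient.mk 1) = u
    rw [Submodule.liftQ_apply]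
    simp
  rw [← h4, h3]; rfl

/-- linear form with given coefficients -/
noncomputable def linF (K : Type) [Field K] (n : ℕ) : (Fin n → K) →ₗ[K] MvPolynomial (Fin n) K :=
  Fintype.linearCombination K (fun i => (X i : MvPolynomial (Fin n) K))

lemma linF_single (K : Type) [Field K] (n : ℕ) (i : Fin n) : linF K n (Pi.single i 1) = X i := by
  simp [linF, Fintype.linearCombination_apply_single]

lemma linF_hom (K : Type) [Field K] (n : ℕ) (v : Fin n → K) : (linF K n v).IsHomogeneous 1 := by
  rw [linF, Fintype.linearCombination_apply]
  refine IsHomogeneous.sum _ _ _ fun i _ => ?_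
  rw [smul_eq_C_mul]
  simpa using (isHomogeneous_C (Fin n) (v i)).mul (isHomogeneous_X K i)

lemma exists_reg {K : Type} [Field K] [Infinite K] {n : ℕ} (M : Type) [AddCommGroup M]
    [Module (MvPolynomial (Fin n) K) M] [Module.Finite (MvPolynomial (Fin n) K) M] (p : ℕ)
    (hp : p < n) (hM : HasProjectiveDimensionLT (ModuleCat.of (MvPolynomial (Fin n) K) M) (p + 1)) :
    ∃ v : Fin n → K, IsSMulRegular M (linF K n v) := by
  let B := MvPolynomial (Fin n) K
  have hfin : (associatedPrimes B M).Finite := associatedPrimes.finite B M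
  let s : Set (Subspace K (Fin n → K)) :=
    (fun P : Ideal B => (P.restrictScalars K).comap (linF K n)) '' associatedPrimes B M
  have hs : s.Finite := hfin.image _
  have htop : ⊤ ∉ s := by
    rintro ⟨P, hP, hPt⟩
    obtain ⟨hPp, u, hu⟩ := isAssociatedPrime_iff.1 (AssociatedPrimes.mem_iff.1 hP)
    have h0 : u = 0 := by
      refine no_socle M p hp hM u fun a => ?_
      have : Pi.single a (1 : K) ∈ (P.restrictScalars K).comap (linF K n) := by
        beta_reduce at hPt; rw [hPt]; trivial
      rw [Submodule.mem_comap, linF_single, Submodule.restrictScalars_mem, hu,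
        Submodule.mem_colon_singleton] at this
      simpa using this
    apply hPp.ne_top
    rw [hu, h0, Ideal.eq_top_iff_one, Submodule.mem_colon_singleton]
    simp
  have := Subspace.biUnion_ne_univ_of_top_notMem (s := hs.toFinset) (by simpa using htop)
  obtain ⟨v, hv⟩ := (Set.ne_univ_iff_exists_notMem _).1 this
  refine ⟨v, ?_⟩
  by_contra hc
  have : linF K n v ∈ ⋃ P ∈ associatedPrimes B M, (P : Set B) := by
    rw [biUnion_associatedPrimes_eq_compl_regular]
    exact hc
  simp only [Set.mem_iUnion] at this hv
  obtain ⟨P, hP, hvP⟩ := this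
  exact hv ⟨_, hs.mem_toFinset.2 ⟨P, hP, rfl⟩, hvP⟩


lemma hom_bound {K : Type} [Field K] {p d : ℕ} {ι : Type} [Fintype ι]
    (g : ι → MvPolynomial (Fin p) K) (hg : ∀ i, (g i).IsHomogeneous d)
    (hl : LinearIndependent K g) : Fintype.card ι ≤ Nat.multichoose p d := by
  let c : MvPolynomial (Fin p) K →ₗ[K] (Sym (Fin p) d → K) :=
    LinearMap.pi fun s => lcoeff K (Multiset.toFinsupp s.1)
  have hl2 : LinearIndependent K (c ∘ g) := by
    rw [Fintype.linearIndependent_iff] at hl ⊢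
    intro a ha
    apply hl a
    have hh : (∑ i, a i • g i).IsHomogeneous d := by
      refine IsHomogeneous.sum _ _ _ fun i _ => ?_
      exact (homogeneousSubmodule (Fin p) K d).smul_mem _ (hg i)
    have h0 : c (∑ i, a i • g i) = 0 := by
      rw [map_sum]; simpa using ha
    ext m
    by_contra hm
    have hdeg := hh.coeff_eq_zero (d := m)
    have hmd : m.degree = d := by
      by_contra h
      exact hm (by rw [hdeg h, coeff_zero])
    have := congrFun h0 ⟨Finsupp.toMultiset m, by rw [Finsupp.card_toMultiset]; exact hmd⟩
    apply hm
    rw [coeff_zero]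
    change coeff (Multiset.toFinsupp (Finsupp.toMultiset m)) (∑ i, a i • g i) = 0 at this
    rwa [Finsupp.toMultiset_toFinsupp] at this
  have h1 := hl2.fintype_card_le_finrank
  rw [Module.finrank_fintype_fun_eq_card, Sym.card_sym_eq_multichoose, Fintype.card_fin] at h1
  exact h1

/-- ideal generated by the linear forms in `W` -/
noncomputable def linI {K : Type} [Field K] {n : ℕ} (W : Submodule K (Fin n → K)) :
    Ideal (MvPolynomial (Fin n) K) := Ideal.span (linF K n '' W)

lemma linI_mono {K : Type} [Field K] {n : ℕ} {W W' : Submodule K (Fin n → K)} (h : W ≤ W') :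
    linI W ≤ linI W' := Ideal.span_mono (Set.image_mono h)

lemma linI_sup {K : Type} [Field K] {n : ℕ} (W : Submodule K (Fin n → K)) (v : Fin n → K) :
    linI (W ⊔ Submodule.span K {v}) = linI W ⊔ Ideal.span {linF K n v} := by
  apply le_antisymm
  · refine Ideal.span_le.2 ?_
    rintro _ ⟨w, hw, rfl⟩
    obtain ⟨a, ha, b, hb, rfl⟩ := Submodule.mem_sup.1 hw
    obtain ⟨c, rfl⟩ := Submodule.mem_span_singleton.1 hb
    rw [map_add, map_smul, smul_eq_C_mul]
    exact add_mem (Submodule.mem_sup_left (Ideal.subset_span ⟨a, ha, rfl⟩))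
      (Submodule.mem_sup_right (Ideal.mul_mem_left _ _ (Ideal.mem_span_singleton_self _)))
  · refine sup_le (linI_mono le_sup_left) ?_
    rw [Ideal.span_singleton_le_iff_mem]
    exact Ideal.subset_span ⟨v, Submodule.mem_sup_right (Submodule.mem_span_singleton_self v), rfl⟩

attribute [local instance] MvPolynomial.gradedAlgebra in
lemma linI_comp {K : Type} [Field K] {n : ℕ} (W : Submodule K (Fin n → K))
    (f : MvPolynomial (Fin n) K) (hf : f ∈ linI W) (d : ℕ) : homogeneousComponent d f ∈ linI W := by
  have : (linI W).IsHomogeneous (homogeneousSubmodule (Fin n) K) := by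
    refine Ideal.homogeneous_span _ _ ?_
    rintro _ ⟨w, _, rfl⟩
    exact ⟨1, linF_hom K n w⟩
  exact (mem_iff_homogeneousComponent_mem this f).1 hf d

lemma hom_mem_pow {K : Type} [Field K] {n d : ℕ} (f : MvPolynomial (Fin n) K)
    (hf : f.IsHomogeneous d) : f ∈ idealOfVars (Fin n) K ^ d := by
  rw [mem_pow_idealOfVars_iff']
  intro x hx
  by_contra h
  have := hf.coeff_eq_zero (d := x)
  exact h (this (by have := hx; omega))

lemma pow_comp {K : Type} [Field K] {n d : ℕ} (f : MvPolynomial (Fin n) K)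
    (hf : f ∈ idealOfVars (Fin n) K ^ (d + 1)) : homogeneousComponent d f = 0 := by
  rw [mem_pow_idealOfVars_iff] at hf
  refine homogeneousComponent_eq_zero' _ _ fun x hx h => ?_
  have := hf x hx
  omega

lemma cut {K : Type} [Field K] [Infinite K] {n d p : ℕ} (hd : 0 < d)
    (J : Ideal (MvPolynomial (Fin n) K)) (hJ : J ≤ idealOfVars (Fin n) K ^ d)
    (hpd : HasProjectiveDimensionLT
      (ModuleCat.of (MvPolynomial (Fin n) K) (MvPolynomial (Fin n) K ⧸ J)) (p + 1)) (r : ℕ)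
    (hr : r + p ≤ n) : ∃ W : Submodule K (Fin n → K), Module.finrank K W = r ∧
      HasProjectiveDimensionLT (ModuleCat.of (MvPolynomial (Fin n) K)
        (MvPolynomial (Fin n) K ⧸ (J ⊔ linI W))) (p + r + 1) ∧
      ∀ f ∈ J, f.IsHomogeneous d → f ∈ linI W → f = 0 := by
  induction r with
  | zero =>
    have h0 : linI (⊥ : Submodule K (Fin n → K)) = ⊥ := by simp [linI]
    refine ⟨⊥, by simp, ?_, ?_⟩
    · rw [h0, sup_bot_eq]; exact hpd
    · rw [h0]; intro f _ _ h; simpa using h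
  | succ r ih =>
    obtain ⟨W, hW, hpW, hf⟩ := ih (by omega)
    obtain ⟨v, hv⟩ := exists_reg (MvPolynomial (Fin n) K ⧸ (J ⊔ linI W)) (p + r) (by omega) hpW
    have hreg : ∀ g, linF K n v * g ∈ J ⊔ linI W → g ∈ J ⊔ linI W := by
      intro g hg
      have h1 : linF K n v • (Submodule.Quotient.mk g : MvPolynomial (Fin n) K ⧸ (J ⊔ linI W))
          = linF K n v • 0 := by
        rw [smul_zero, ← Submodule.Quotient.mk_smul, Submodule.Quotient.mk_eq_zero]
        exact hg
      exact (Submodule.Quotient.mk_eq_zero _).1 (hv h1)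
    have hlin : ∀ w, linF K n w ∈ idealOfVars (Fin n) K := fun w => by
      simpa using hom_mem_pow _ (linF_hom K n w)
    have hprop : J ⊔ linI W ≤ idealOfVars (Fin n) K := by
      refine sup_le (hJ.trans (Ideal.pow_le_self (by omega))) (Ideal.span_le.2 ?_)
      rintro _ ⟨w, _, rfl⟩
      exact hlin w
    have hvW : v ∉ W := by
      intro hvW
      have h1 := hreg 1 (by
        rw [mul_one]; exact Submodule.mem_sup_right (Ideal.subset_span ⟨v, hvW, rfl⟩))
      have h2 := hprop h1
      rw [← pow_one (idealOfVars (Fin n) K), ← C_1, C_mem_pow_idealOfVars_iff] at h2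
      simp at h2
    refine ⟨W ⊔ Submodule.span K {v}, ?_, ?_, ?_⟩
    · rw [Submodule.finrank_sup_span_singleton hvW, hW]
    · rw [linI_sup, ← sup_assoc]
      exact pd_step _ _ hreg _ hpW
    · intro f hfJ hfd hfW
      apply hf f hfJ hfd
      rw [linI_sup] at hfW
      obtain ⟨a, ha, b, hb, rfl⟩ := Submodule.mem_sup.1 hfW
      obtain ⟨g, rfl⟩ := Ideal.mem_span_singleton'.1 hb
      have hg : g ∈ J ⊔ linI W := by
        apply hreg
        have : linF K n v * g = (a + g * linF K n v) - a := by ring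
        rw [this]
        exact sub_mem (Submodule.mem_sup_left hfJ) (Submodule.mem_sup_right ha)
      obtain ⟨j, hj, b, hb', rfl⟩ := Submodule.mem_sup.1 hg
      have h1 : homogeneousComponent d (a + (j + b) * linF K n v) = a + (j + b) * linF K n v := by
        rw [homogeneousComponent_of_mem (n := d) hfd, if_pos rfl]
      have h2 : a + (j + b) * linF K n v = (a + b * linF K n v) + j * linF K n v := by ring
      rw [← h1, h2, map_add, pow_comp (j * linF K n v), add_zero]
      · apply linI_comp
        exact add_mem ha (Ideal.mul_mem_right _ _ hb')
      · rw [pow_succ]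
        exact Ideal.mul_mem_mul (hJ hj) (hlin v)

lemma bound_inf {K : Type} [Field K] [Infinite K] {n d p : ℕ} (hd : 0 < d)
    (J : Ideal (MvPolynomial (Fin n) K)) (hJ : J ≤ idealOfVars (Fin n) K ^ d)
    (hpd : HasProjectiveDimensionLT
      (ModuleCat.of (MvPolynomial (Fin n) K) (MvPolynomial (Fin n) K ⧸ J)) (p + 1))
    (hp : p ≤ n) {ι : Type} [Fintype ι]
    (g : ι → MvPolynomial (Fin n) K) (hg : ∀ i, (g i).IsHomogeneous d) (hgJ : ∀ i, g i ∈ J)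
    (hl : LinearIndependent K g) : Fintype.card ι ≤ Nat.multichoose p d := by
  obtain ⟨W, hW, -, hf⟩ := cut hd J hJ hpd (n - p) (by omega)
  have hq : Module.finrank K ((Fin n → K) ⧸ W) = Module.finrank K (Fin p → K) := by
    have := W.finrank_quotient_add_finrank
    simp only [Module.finrank_fin_fun] at this ⊢
    omega
  let E : ((Fin n → K) ⧸ W) ≃ₗ[K] (Fin p → K) := LinearEquiv.ofFinrankEq _ _ hq
  let c : (Fin n → K) →ₗ[K] (Fin p → K) := E.toLinearMap ∘ₗ W.mkQ
  have hc : Function.Surjective c := E.surjective.comp W.mkQ_surjective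
  obtain ⟨s, hs⟩ := c.exists_rightInverse_of_surjective (LinearMap.range_eq_top.2 hc)
  let ψ : MvPolynomial (Fin n) K →ₐ[K] MvPolynomial (Fin p) K :=
    aeval fun i => linF K p (c (Pi.single i 1))
  let φ : MvPolynomial (Fin p) K →ₐ[K] MvPolynomial (Fin n) K :=
    aeval fun i => linF K n (s (Pi.single i 1))
  have hφ : ∀ w, φ (linF K p w) = linF K n (s w) := by
    have : φ.toLinearMap ∘ₗ linF K p = linF K n ∘ₗ s := by
      ext i : 2
      simp [linF_single, φ]
    exact fun w => LinearMap.congr_fun this w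
  have hψφ : ∀ f, ψ f = 0 → f ∈ linI W := by
    intro f h0
    have h1 : (Ideal.Quotient.mkₐ K (linI W)).comp (φ.comp ψ) = Ideal.Quotient.mkₐ K (linI W) := by
      refine MvPolynomial.algHom_ext fun i => ?_
      show Ideal.Quotient.mk _ (φ (ψ (X i))) = Ideal.Quotient.mk _ (X i)
      rw [Ideal.Quotient.eq]
      have : ψ (X i) = linF K p (c (Pi.single i 1)) := by simp [ψ]
      rw [this, hφ, ← linF_single, ← map_sub]
      refine Ideal.subset_span ⟨_, ?_, rfl⟩
      have h3 : c (s (c (Pi.single i 1)) - Pi.single i 1) = 0 := by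
        rw [map_sub, show c (s (c (Pi.single i 1))) = _ from LinearMap.congr_fun hs _]
        simp
      have h4 : W.mkQ (s (c (Pi.single i 1)) - Pi.single i 1) = 0 := E.injective (by
        rw [map_zero]; exact h3)
      simpa using (Submodule.Quotient.mk_eq_zero W).1 h4
    have h2 := AlgHom.congr_fun h1 f
    change Ideal.Quotient.mk _ (φ (ψ f)) = Ideal.Quotient.mk _ f at h2
    rw [h0, map_zero, map_zero, eq_comm, Ideal.Quotient.eq_zero_iff_mem] at h2
    exact h2
  refine hom_bound (fun i => ψ (g i)) (fun i => ?_) ?_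
  · have := (hg i).aeval (fun i => linF K p (c (Pi.single i 1))) (n := 1) fun i => linF_hom K p _
    simpa [ψ] using this
  · rw [Fintype.linearIndependent_iff] at hl ⊢
    intro a ha
    apply hl a
    apply hf
    · exact sum_mem fun i _ => by
        rw [smul_eq_C_mul]; exact Ideal.mul_mem_left _ _ (hgJ i)
    · refine IsHomogeneous.sum _ _ _ fun i _ => ?_
      exact (homogeneousSubmodule (Fin n) K d).smul_mem _ (hg i)
    · apply hψφ
      rw [map_sum]
      simpa using ha


lemma f_props {k : Type} [Field k] {n : ℕ} {I : Ideal (MvPolynomial (Fin n) k)} (d : ℕ)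
    (res : MinGradedFreeRes (MvPolynomial (Fin n) k)
      (fun m => {f | MvPolynomial.IsHomogeneous f m})
      (MvPolynomial (Fin n) k ⧸ I))
    (h0 : ∀ j : ℤ, res.β 0 j = if j = 0 then 1 else 0) :
    ∃ f : Fin (res.β 1 d) → MvPolynomial (Fin n) k,
      (∀ a, (f a).IsHomogeneous d) ∧ (∀ a, f a ∈ I) ∧ LinearIndependent k f := by
  have h00 : res.β 0 0 = 1 := by rw [h0]; simp
  let z : (j : ℤ) × Fin (res.β 0 j) := ⟨0, ⟨0, by omega⟩⟩
  have hz : ∀ x, x = z := by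
    rintro ⟨j, a⟩
    have hj : j = 0 := by
      by_contra h
      have h2 := h0 j
      rw [if_neg h] at h2
      have := a.2
      omega
    subst hj
    have : a = ⟨0, by omega⟩ := by ext; have := a.2; simp; omega
    rw [this]
  have hsing : ∀ x : FreeMod (MvPolynomial (Fin n) k) (res.β 0), x = x z • Finsupp.single z 1 := by
    intro x
    ext y : 1
    rw [hz y]; simp
  let e : (a : Fin (res.β 1 d)) → (j : ℤ) × Fin (res.β 1 j) := fun a => ⟨d, a⟩
  let f : Fin (res.β 1 d) → MvPolynomial (Fin n) k := fun a => res.d 0 (Finsupp.single (e a) 1) z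
  refine ⟨f, ?_, ?_, ?_⟩
  · intro a
    rcases res.graded 0 d a 0 ⟨0, by omega⟩ with h | ⟨m, hm, h⟩
    · change f a = 0 at h
      rw [h]; exact isHomogeneous_zero _ _ _
    · change (f a).IsHomogeneous m at h
      have : m = d := by omega
      rwa [this] at h
  · intro a
    obtain ⟨x, hx⟩ := res.augSurj 1
    have h2 : res.aug (res.d 0 (Finsupp.single (e a) 1)) = 0 := by
      rw [← LinearMap.mem_ker, ← res.exact₀]; exact ⟨_, rfl⟩
    rw [hsing (res.d 0 _), map_smul] at h2
    rw [hsing x, map_smul] at hx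
    have h3 : f a • (1 : MvPolynomial (Fin n) k ⧸ I) = 0 := by
      rw [← hx, smul_comm]
      change x z • (res.d 0 (Finsupp.single (e a) 1) z • _) = 0
      rw [h2, smul_zero]
    rw [← Ideal.Quotient.eq_zero_iff_mem, ← h3]
    change _ = Ideal.Quotient.mk I (f a • 1)
    rw [smul_eq_mul, mul_one]
  · rw [Fintype.linearIndependent_iff]
    intro c hc a
    let y : FreeMod (MvPolynomial (Fin n) k) (res.β 1) :=
      ∑ a, (C (c a) : MvPolynomial (Fin n) k) • Finsupp.single (e a) 1
    have hy : y ∈ LinearMap.ker (res.d 0) := by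
      rw [LinearMap.mem_ker, hsing (res.d 0 y)]
      have : res.d 0 y z = 0 := by
        rw [← hc, map_sum, Finsupp.finsetSum_apply]
        refine Finset.sum_congr rfl fun a _ => ?_
        rw [map_smul, Finsupp.smul_apply, smul_eq_mul, smul_eq_C_mul]
      rw [this, zero_smul]
    rw [← res.exact 0] at hy
    obtain ⟨w, hw⟩ := hy
    have key : ∀ w x, constantCoeff (res.d 1 w x) = 0 := by
      intro w x
      induction w using Finsupp.induction_linear with
      | zero => simp
      | add u v hu hv => rw [map_add, Finsupp.add_apply, map_add, hu, hv, add_zero]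
      | single s r =>
        have : Finsupp.single s r = r • Finsupp.single s (1 : MvPolynomial (Fin n) k) := by simp
        rw [this, map_smul, Finsupp.smul_apply, smul_eq_mul, map_mul]
        obtain ⟨j, b⟩ := s
        obtain ⟨j', b'⟩ := x
        convert mul_zero _
        by_cases hne : res.d 1 (Finsupp.single ⟨j, b⟩ 1) ⟨j', b'⟩ = 0
        · rw [hne, map_zero]
        have hlt := res.minimal 1 j b j' b' hne
        rcases res.graded 1 j b j' b' with h | ⟨m, hm, h⟩
        · exact absurd h hne
        · have h' : (res.d 1 (Finsupp.single ⟨j, b⟩ 1) ⟨j', b'⟩).IsHomogeneous m := h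
          rw [constantCoeff_eq]
          apply h'.coeff_eq_zero
          simp
          omega
    have h5 := key w (e a)
    change constantCoeff ((res.d (0+1) w) (e a)) = 0 at h5
    rw [hw] at h5
    have h6 : y (e a) = C (c a) := by
      simp only [y, Finsupp.finsetSum_apply, Finsupp.smul_apply]
      rw [Finset.sum_eq_single a]
      · simp
      · intro b _ hb
        rw [Finsupp.single_eq_of_ne, smul_zero]
        intro h
        apply hb
        have := eq_of_heq (Sigma.mk.inj h).2
        exact this.symm
      · simp
    rw [h6] at h5
    simpa using h5

attribute [local instance] MvPolynomial.algebraMvPolynomial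

lemma flat_ext (k K : Type) [Field k] [Field K] [Algebra k K] (n : ℕ) :
    Module.Flat (MvPolynomial (Fin n) k) (MvPolynomial (Fin n) K) := by
  have : Algebra.IsPushout k (MvPolynomial (Fin n) k) K (MvPolynomial (Fin n) K) := inferInstance
  exact Module.Flat.isBaseChange k (MvPolynomial (Fin n) k) K (MvPolynomial (Fin n) K) this.out

lemma pd_ext {S B : Type} [CommRing S] [CommRing B] [Algebra S B] [Module.Flat S B]
    {hom : ℕ → Set S} {I : Ideal S} (res : MinGradedFreeRes S hom (S ⧸ I)) (p : ℕ)
    (hlen : ∀ i, p < i → res.β i = 0) :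
    HasProjectiveDimensionLT (ModuleCat.of B (B ⧸ I.map (algebraMap S B))) (p + 1) := by
  let E : TensorProduct S B (S ⧸ I) ≃ₗ[B] (B ⧸ I.map (algebraMap S B)) :=
    (Algebra.TensorProduct.quotIdealMapEquivTensorQuot B I).symm.toLinearEquiv
  refine pd_of_res p _ (fun i => TensorProduct S B (FreeMod S (res.β i)))
    (fun i => (res.d i).baseChange B) (E.toLinearMap ∘ₗ res.aug.baseChange B) ?_ ?_ ?_ ?_
  · exact E.surjective.comp (LinearMap.lTensor_surjective B res.augSurj)
  · have h1 : Function.Exact (res.d 0) res.aug := LinearMap.exact_iff.2 res.exact₀.symm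
    have h2 := Module.Flat.lTensor_exact B h1
    intro x
    exact E.map_eq_zero_iff.trans (h2 x)
  · intro i
    have h1 : Function.Exact (res.d (i+1)) (res.d i) := LinearMap.exact_iff.2 (res.exact i).symm
    exact Module.Flat.lTensor_exact B h1
  · intro i hi
    have : IsEmpty ((j : ℤ) × Fin (res.β i j)) := by
      rw [hlen i hi]; constructor; rintro ⟨j, a⟩; exact a.elim0
    have : Subsingleton (FreeMod S (res.β i)) := inferInstance
    refine subsingleton_of_forall_eq 0 fun x => ?_
    induction x using TensorProduct.induction_on with
    | zero => rfl
    | tmul b m => rw [Subsingleton.elim m 0, TensorProduct.tmul_zero]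
    | add u v hu hv => rw [hu, hv, add_zero]

lemma lin_ext {k K : Type} [Field k] [Field K] [Algebra k K] {n : ℕ} {ι : Type} [Fintype ι]
    (f : ι → MvPolynomial (Fin n) k) (hf : LinearIndependent k f) :
    LinearIndependent K (fun a => MvPolynomial.map (algebraMap k K) (f a)) := by
  rw [Fintype.linearIndependent_iff] at hf ⊢
  intro c hc a
  rw [← Module.forall_dual_apply_eq_zero_iff k]
  intro φ
  refine hf (fun a => φ (c a)) ?_ a
  ext m
  have h1 := congrArg (fun q => φ (coeff m q)) hc
  simp only [coeff_sum, coeff_smul, coeff_map, coeff_zero, map_zero, map_sum] at h1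
  rw [coeff_sum, coeff_zero, ← h1]
  refine Finset.sum_congr rfl fun a _ => ?_
  rw [coeff_smul, smul_eq_mul, smul_eq_mul, mul_comm (c a), ← Algebra.smul_def, map_smul,
    smul_eq_mul, mul_comm]

lemma mu_aux {k : Type} [Field k] {n : ℕ} {I : Ideal (MvPolynomial (Fin n) k)} {d : ℕ}
    (hgen : ∃ G : Set (MvPolynomial (Fin n) k),
      (∀ g ∈ G, MvPolynomial.IsHomogeneous g d) ∧ Ideal.span G = I)
    (res : MinGradedFreeRes (MvPolynomial (Fin n) k)
      (fun m => {f | MvPolynomial.IsHomogeneous f m})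
      (MvPolynomial (Fin n) k ⧸ I))
    (p : ℕ) (hlen : ∀ i, p < i → res.β i = 0) (hpn : p ≤ n) (hd : 0 < d)
    {ι : Type} [Fintype ι] (f : ι → MvPolynomial (Fin n) k) (hf : ∀ a, (f a).IsHomogeneous d)
    (hfI : ∀ a, f a ∈ I) (hl : LinearIndependent k f) :
    Fintype.card ι ≤ Nat.multichoose p d := by
  let K := AlgebraicClosure k
  have := flat_ext k K n
  have hinf : Infinite K := inferInstance
  have hmap : ∀ q : MvPolynomial (Fin n) k,
      algebraMap (MvPolynomial (Fin n) k) (MvPolynomial (Fin n) K) q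
        = MvPolynomial.map (algebraMap k K) q := fun _ => rfl
  have hpd := pd_ext (B := MvPolynomial (Fin n) K) res p hlen
  refine bound_inf hd _ ?_ hpd hpn (fun a => MvPolynomial.map (algebraMap k K) (f a))
    (fun a => (hf a).map _) (fun a => ?_) (lin_ext f hl)
  · obtain ⟨G, hG, rfl⟩ := hgen
    rw [Ideal.map_span]
    refine Ideal.span_le.2 ?_
    rintro _ ⟨g, hg, rfl⟩
    exact hom_mem_pow _ ((hG g hg).map _)
  · exact Ideal.mem_map_of_mem _ (hfI a)

end Helpers

/-- Let `S = k[x₁,…,xₙ]` and `I ⊂ S` a homogeneous ideal generated in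
degree `d` with `p = pdim_S (S/I)`.  Then the minimal number of generators of `I`
(that is `μ(I) = β₁(S/I) = dim_k I_d`, the first total Betti number of the minimal graded
free resolution of `S/I`) satisfies `μ(I) ≤ C(d + p − 1, p − 1)`. -/
theorem mu_le_choose
    (k : Type) [Field k] (n : ℕ) (I : Ideal (MvPolynomial (Fin n) k)) (d : ℕ)
    (hgen : ∃ G : Set (MvPolynomial (Fin n) k),
      (∀ g ∈ G, MvPolynomial.IsHomogeneous g d) ∧ Ideal.span G = I)
    (res : MinGradedFreeRes (MvPolynomial (Fin n) k)
      (fun m => {f | MvPolynomial.IsHomogeneous f m})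
      (MvPolynomial (Fin n) k ⧸ I))
    (h0 : ∀ j : ℤ, res.β 0 j = if j = 0 then 1 else 0)
    (h1 : ∀ j : ℤ, res.β 1 j ≠ 0 → j = (d : ℤ))
    (p : ℕ) (hlen : ∀ i, p < i → res.β i = 0) (hp : res.β p ≠ 0) :
    res.tB 1 ≤ Nat.choose (d + p - 1) (p - 1) := by
  have htB : res.tB 1 ≤ res.β 1 d := by
    unfold MinGradedFreeRes.tB
    calc _ ≤ ∑ j ∈ {(d : ℤ)}, res.β 1 j := by
          refine Finset.sum_le_sum_of_subset ?_
          intro j hj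
          rw [Finset.mem_singleton]
          exact h1 j (by simpa using hj)
      _ = _ := by simp
  refine htB.trans ?_
  rcases Nat.eq_zero_or_pos p with rfl | hpos
  · rw [hlen 1 one_pos]; simp
  have hR : Nat.choose (d + p - 1) (p - 1) = Nat.multichoose p d := by
    rw [Nat.multichoose_eq, add_comm p d]
    exact Nat.choose_symm_of_eq_add (by omega)
  rw [hR]
  obtain ⟨f, hf, hfI, hl⟩ := f_props d res h0
  rw [← Fintype.card_fin (res.β 1 d)]
  by_cases hc : p ≤ n ∧ 0 < d
  · exact mu_aux hgen res p hlen hc.1 hc.2 f hf hfI hl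
  · refine (hom_bound f hf hl).trans ?_
    rcases Nat.eq_zero_or_pos d with rfl | hd
    · simp
    · have : n ≤ p := by
        by_contra h
        exact hc ⟨by omega, hd⟩
      rw [Nat.multichoose_eq, Nat.multichoose_eq]
      exact Nat.choose_le_choose _ (by omega)
end
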